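/- arXiv:2603.01797 — 4 statements merged into one kernel-verified Lean document; each statement's English description precedes it below -/
import Mathlib

section
/- Suppose additionally that ∂_yU^in is continuous on [0,1] and c₀ ≤ ∂_yU^in(y) ≤ C₀ for all y ∈ [0,1], with 0 < c₀ ≤ C₀. Then for all t ≥ 0 and all y ∈ [0,1], c₀ ≤ ∂_yU(t,y) ≤ C₀. -/
open MeasureTheory Set

noncomputable section

/-- Derivative within `[0,1]` (real-valued). -/
def dYr (g : ℝ → ℝ) (y : ℝ) : ℝ := derivWithin g (Set.Icc 0 1) y

/-- Derivative within `[0,1]` (complex-valued). -/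
def dYc (g : ℝ → ℂ) (y : ℝ) : ℂ := derivWithin g (Set.Icc 0 1) y

/-- The condition (M) on the initial shear profile `U^in`:
`U^in ∈ H⁴(0,1)`, `∂_y U^in ≥ c₀ > 0`, `∂_y² U^in` of one sign, vanishing at the endpoints. -/
def CondM (Uin : ℝ → ℝ) : Prop :=
  ContDiffOn ℝ 4 Uin (Set.Icc 0 1) ∧
  (∃ c₀ > (0:ℝ), ∀ y ∈ Set.Icc (0:ℝ) 1, c₀ ≤ dYr Uin y) ∧
  ((∀ y ∈ Set.Ioo (0:ℝ) 1, 0 ≤ dYr (dYr Uin) y) ∨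
    (∀ y ∈ Set.Ioo (0:ℝ) 1, dYr (dYr Uin) y ≤ 0)) ∧
  dYr (dYr Uin) 0 = 0 ∧ dYr (dYr Uin) 1 = 0

/-- `U` is a classical solution of `∂_t U = ν ∂_y² U` on `(0,∞)×(0,1)` with
initial datum `U^in` and constant Dirichlet boundary values `U^in(0)`, `U^in(1)`. -/
def HeatFlow (ν : ℝ) (Uin : ℝ → ℝ) (U : ℝ → ℝ → ℝ) : Prop :=
  ContinuousOn (fun p : ℝ × ℝ => U p.1 p.2) (Set.Ici 0 ×ˢ Set.Icc 0 1) ∧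
  ContDiffOn ℝ (⊤ : ℕ∞) (fun p : ℝ × ℝ => U p.1 p.2) (Set.Ioi 0 ×ˢ Set.Icc 0 1) ∧
  (∀ t > (0:ℝ), ∀ y ∈ Set.Ioo (0:ℝ) 1,
    deriv (fun s => U s y) t = ν * dYr (dYr (U t)) y) ∧
  (∀ y ∈ Set.Icc (0:ℝ) 1, U 0 y = Uin y) ∧
  (∀ t ≥ (0:ℝ), U t 0 = Uin 0 ∧ U t 1 = Uin 1)

/-- `sup_{t ≥ 0, y ∈ [0,1]} ∂_y U(t,y)`. -/
def supDyU (U : ℝ → ℝ → ℝ) : ℝ :=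
  ⨆ t : Set.Ici (0:ℝ), ⨆ y : Set.Icc (0:ℝ) 1, dYr (U (t : ℝ)) (y : ℝ)

/-- `(ω,ψ)` is a smooth solution of the linearized Navier–Stokes system at
frequency `k` around the shear flow `U(t,y)`, with forcings `f₁`, `f₂`. -/
def LinNS (ν : ℝ) (k : ℤ) (U : ℝ → ℝ → ℝ) (ω ψ f₁ f₂ : ℝ → ℝ → ℂ) : Prop :=
  ContDiffOn ℝ (⊤ : ℕ∞) (fun p : ℝ × ℝ => ω p.1 p.2) (Set.Ici 0 ×ˢ Set.Icc 0 1) ∧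
  ContDiffOn ℝ (⊤ : ℕ∞) (fun p : ℝ × ℝ => ψ p.1 p.2) (Set.Ici 0 ×ˢ Set.Icc 0 1) ∧
  (∀ t > (0:ℝ), ∀ y ∈ Set.Ioo (0:ℝ) 1,
    deriv (fun s => ω s y) t
        - (ν : ℂ) * (dYc (dYc (ω t)) y - (k : ℂ) ^ 2 * ω t y)
        + Complex.I * (k : ℂ) * ((U t y : ℝ) : ℂ) * ω t y
        - Complex.I * (k : ℂ) * ((dYr (dYr (U t)) y : ℝ) : ℂ) * ψ t y
      = -(Complex.I) * (k : ℂ) * f₁ t y - dYc (f₂ t) y) ∧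
  (∀ t ≥ (0:ℝ), ∀ y ∈ Set.Ioo (0:ℝ) 1,
    dYc (dYc (ψ t)) y - (k : ℂ) ^ 2 * ψ t y = ω t y) ∧
  (∀ t ≥ (0:ℝ), ψ t 0 = 0 ∧ ψ t 1 = 0 ∧ dYc (ψ t) 0 = 0 ∧ dYc (ψ t) 1 = 0)

/-- The pointwise squared modulus of the velocity `u = (∂_yψ, -ikψ)`. -/
def uSq (k : ℤ) (ψ : ℝ → ℝ → ℂ) (t y : ℝ) : ℝ :=
  ‖dYc (ψ t) y‖ ^ 2 + (k : ℝ) ^ 2 * ‖ψ t y‖ ^ 2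

/-- Squared mixed norm `‖e^{at} u‖²_{L²L²}`. -/
def XL2L2u (a : ℝ) (k : ℤ) (ψ : ℝ → ℝ → ℂ) : ℝ :=
  ∫ t in Set.Ioi (0:ℝ), ∫ y in Set.Ioo (0:ℝ) 1, Real.exp (2 * a * t) * uSq k ψ t y

/-- Squared mixed norm `‖e^{at} g‖²_{L²L²}`. -/
def XL2L2 (a : ℝ) (g : ℝ → ℝ → ℂ) : ℝ :=
  ∫ t in Set.Ioi (0:ℝ), ∫ y in Set.Ioo (0:ℝ) 1, Real.exp (2 * a * t) * ‖g t y‖ ^ 2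

/-- Squared mixed norm `‖e^{at} √(1-(2y-1)²) g‖²_{L^∞L²}`. -/
def XLinfL2w (a : ℝ) (g : ℝ → ℝ → ℂ) : ℝ :=
  ⨆ t : Set.Ici (0:ℝ), Real.exp (2 * a * (t : ℝ)) *
    ∫ y in Set.Ioo (0:ℝ) 1, (1 - (2 * y - 1) ^ 2) * ‖g (t : ℝ) y‖ ^ 2

/-- Squared mixed norm `‖e^{at} g‖²_{L^∞L²}`. -/
def XLinfL2 (a : ℝ) (g : ℝ → ℝ → ℂ) : ℝ :=
  ⨆ t : Set.Ici (0:ℝ), Real.exp (2 * a * (t : ℝ)) *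
    ∫ y in Set.Ioo (0:ℝ) 1, ‖g (t : ℝ) y‖ ^ 2

/-- Squared mixed norm `‖e^{at} u‖²_{L^∞L^∞}`. -/
def XLinfLinfU (a : ℝ) (k : ℤ) (ψ : ℝ → ℝ → ℂ) : ℝ :=
  ⨆ t : Set.Ici (0:ℝ), ⨆ y : Set.Icc (0:ℝ) 1,
    Real.exp (2 * a * (t : ℝ)) * uSq k ψ (t : ℝ) (y : ℝ)

/-- The boundary-layer weight `ρ_k` with parameter `L`. -/
def rhoW (L y : ℝ) : ℝ :=
  if y ≤ L⁻¹ then L * y else if y ≤ 1 - L⁻¹ then 1 else L * (1 - y)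

/-- Squared mixed norm `‖e^{at} ρ_k^{1/2} g‖²_{L²L²}`. -/
def XL2rho (a L : ℝ) (g : ℝ → ℝ → ℂ) : ℝ :=
  ∫ t in Set.Ioi (0:ℝ), ∫ y in Set.Ioo (0:ℝ) 1,
    Real.exp (2 * a * t) * rhoW L y * ‖g t y‖ ^ 2

/-- Squared mixed norm `‖e^{at} g‖²_{L²H¹_k}`. -/
def XL2H1k (a : ℝ) (k : ℤ) (g : ℝ → ℝ → ℂ) : ℝ :=
  ∫ t in Set.Ioi (0:ℝ), ∫ y in Set.Ioo (0:ℝ) 1,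
    Real.exp (2 * a * t) * (‖dYc (g t) y‖ ^ 2 + (k : ℝ) ^ 2 * ‖g t y‖ ^ 2)

/-- The initial energy
`E^in = |k|⁻²‖∂_yω^in‖²_{L²} + ‖u(0,·)‖²_{L²} + ‖∂_y u(0,·)‖²_{L²}`. -/
def Ein (k : ℤ) (ω ψ : ℝ → ℝ → ℂ) : ℝ :=
  ((k : ℝ) ^ 2)⁻¹ * (∫ y in Set.Ioo (0:ℝ) 1, ‖dYc (ω 0) y‖ ^ 2)
    + (∫ y in Set.Ioo (0:ℝ) 1, uSq k ψ 0 y)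
    + (∫ y in Set.Ioo (0:ℝ) 1,
        ‖dYc (dYc (ψ 0)) y‖ ^ 2 + (k : ℝ) ^ 2 * ‖dYc (ψ 0) y‖ ^ 2)


lemma second_deriv_nonneg_of_min {f : ℝ → ℝ} {x : ℝ} (h : IsLocalMin f x)
    (hc : ContinuousAt f x) : 0 ≤ deriv (deriv f) x := by
  by_contra hn
  push Not at hn
  have hmax := isLocalMax_of_deriv_deriv_neg hn h.deriv_eq_zero hc
  have heq : f =ᶠ[nhds x] fun _ => f x := by
    filter_upwards [h, hmax] with z h1 h2
    exact le_antisymm h2 h1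
  have := heq.deriv.deriv_eq
  simp at this
  linarith

lemma heat_maxprin {ν : ℝ} (hν : 0 < ν) {a b T : ℝ} {W : ℝ → ℝ → ℝ}
    (hW : ContinuousOn (fun p : ℝ × ℝ => W p.1 p.2) (Set.Icc 0 T ×ˢ Set.Icc a b))
    (hd : ∀ t ∈ Set.Ioc 0 T, ∀ y ∈ Set.Ioo a b, DifferentiableAt ℝ (fun s => W s y) t ∧
      deriv (fun s => W s y) t = ν * deriv (deriv (W t)) y)
    (h0 : ∀ y ∈ Set.Icc a b, 0 ≤ W 0 y)
    (ha : ∀ t ∈ Set.Icc 0 T, 0 ≤ W t a) (hb : ∀ t ∈ Set.Icc 0 T, 0 ≤ W t b) :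
    ∀ t ∈ Set.Icc 0 T, ∀ y ∈ Set.Icc a b, 0 ≤ W t y := by
  intro t ht y hy
  by_contra hn
  push Not at hn
  have hT : 0 ≤ T := ht.1.trans ht.2
  obtain ⟨ε, hε, hεt⟩ : ∃ ε > 0, W t y + ε * t < 0 := by
    refine ⟨-W t y / (2 * (T + 1)), by apply div_pos <;> linarith, ?_⟩
    have h1 : -W t y / (2 * (T + 1)) * t ≤ -W t y / (2 * (T + 1)) * (T + 1) := by
      apply mul_le_mul_of_nonneg_left (by linarith [ht.2])
      apply div_nonneg <;> linarith
    have h2 : -W t y / (2 * (T + 1)) * (T + 1) = -W t y / 2 := by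
      field_simp
    linarith
  have hcomp : IsCompact (Set.Icc 0 T ×ˢ Set.Icc a b) := isCompact_Icc.prod isCompact_Icc
  have hVc : ContinuousOn (fun p : ℝ × ℝ => W p.1 p.2 + ε * p.1)
      (Set.Icc 0 T ×ˢ Set.Icc a b) := hW.add (by fun_prop)
  obtain ⟨⟨t0, y0⟩, ⟨ht0, hy0⟩, hmin⟩ := hcomp.exists_isMinOn ⟨(t, y), ht, hy⟩ hVc
  simp only at ht0 hy0
  have hmin' : ∀ s ∈ Set.Icc 0 T, ∀ z ∈ Set.Icc a b,
      W t0 y0 + ε * t0 ≤ W s z + ε * s := fun s hs z hz =>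
    hmin (show (s, z) ∈ Set.Icc 0 T ×ˢ Set.Icc a b from ⟨hs, hz⟩)
  have hneg : W t0 y0 + ε * t0 < 0 := (hmin' t ht y hy).trans_lt hεt
  have hεt0 : 0 ≤ ε * t0 := mul_nonneg hε.le ht0.1
  have ht0pos : 0 < t0 := by
    rcases ht0.1.eq_or_lt with h | h
    · have := h0 y0 hy0
      rw [h] at this
      linarith
    · exact h
  have hay : a < y0 := by
    rcases hy0.1.eq_or_lt with h | h
    · have := ha t0 ht0
      rw [h] at this
      linarith
    · exact h
  have hyb : y0 < b := by
    rcases hy0.2.eq_or_lt with h | h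
    · have := hb t0 ht0
      rw [← h] at this
      linarith
    · exact h
  obtain ⟨hdt, heq⟩ := hd t0 ⟨ht0pos, ht0.2⟩ y0 ⟨hay, hyb⟩
  have hnh : Set.Icc a b ∈ nhds y0 := Icc_mem_nhds hay hyb
  have hyy : 0 ≤ deriv (deriv (W t0)) y0 := by
    apply second_deriv_nonneg_of_min
    · filter_upwards [hnh] with z hz
      have := hmin' t0 ht0 z hz
      linarith
    · have h1 : ContinuousOn (fun z => W t0 z) (Set.Icc a b) :=
        hW.comp (f := fun z : ℝ => ((t0, z) : ℝ × ℝ)) (by fun_prop) (fun z hz => ⟨ht0, hz⟩)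
      exact h1.continuousAt hnh
  have hder : HasDerivAt (fun s => W s y0 + ε * s) (deriv (fun s => W s y0) t0 + ε) t0 := by
    have := hdt.hasDerivAt.add ((hasDerivAt_id t0).const_mul ε)
    simp only [mul_one] at this
    exact this
  have hle : deriv (fun s => W s y0) t0 + ε ≤ 0 := by
    have h1 := hder.hasDerivWithinAt (s := Set.Iio t0)
    rw [hasDerivWithinAt_iff_tendsto_slope' (by simp)] at h1
    refine le_of_tendsto h1 ?_
    have : Set.Ioo 0 t0 ∈ nhdsWithin t0 (Set.Iio t0) := Ioo_mem_nhdsLT ht0pos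
    filter_upwards [this] with s hs
    rw [slope_def_field]
    apply div_nonpos_of_nonneg_of_nonpos
    · have := hmin' s ⟨hs.1.le, hs.2.le.trans ht0.2⟩ y0 hy0
      linarith
    · linarith [hs.2]
  have := mul_nonneg hν.le hyy
  linarith

lemma dYr_eventuallyEq (g : ℝ → ℝ) {y : ℝ} (hy : y ∈ Set.Ioo (0:ℝ) 1) :
    dYr g =ᶠ[nhds y] deriv g := by
  filter_upwards [Ioo_mem_nhds hy.1 hy.2] with z hz
  exact derivWithin_of_mem_nhds (Icc_mem_nhds hz.1 hz.2)

lemma dYr_dYr (g : ℝ → ℝ) {y : ℝ} (hy : y ∈ Set.Ioo (0:ℝ) 1) :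
    dYr (dYr g) y = deriv (deriv g) y := by
  rw [(dYr_eventuallyEq (dYr g) hy).eq_of_nhds, (dYr_eventuallyEq g hy).deriv_eq]

lemma heat_reg {ν : ℝ} {f : ℝ → ℝ} {U : ℝ → ℝ → ℝ} (hU : HeatFlow ν f U)
    {t y : ℝ} (ht : 0 < t) (hy : y ∈ Set.Ioo (0:ℝ) 1) :
    DifferentiableAt ℝ (fun s => U s y) t ∧ ContDiffAt ℝ 2 (U t) y ∧
      deriv (fun s => U s y) t = ν * deriv (deriv (U t)) y := by
  have hc : ContDiffAt ℝ 2 (fun p : ℝ × ℝ => U p.1 p.2) (t, y) := by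
    have := hU.2.1.contDiffAt (x := (t, y))
      (prod_mem_nhds (Ioi_mem_nhds ht) (Icc_mem_nhds hy.1 hy.2))
    exact this.of_le (WithTop.coe_le_coe.2 (le_top : (2:ℕ∞) ≤ ⊤))
  refine ⟨?_, ?_, ?_⟩
  · have := hc.differentiableAt (by norm_num)
    exact this.comp (f := fun s : ℝ => ((s, y) : ℝ × ℝ)) t (by fun_prop)
  · exact hc.comp (f := fun z : ℝ => ((t, z) : ℝ × ℝ)) y (by fun_prop)
  · rw [hU.2.2.1 t ht y hy, dYr_dYr _ hy]

lemma ContDiffAt.ev_diff {g : ℝ → ℝ} {y : ℝ} (h : ContDiffAt ℝ 2 g y) :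
    ∀ᶠ z in nhds y, DifferentiableAt ℝ g z := by
  filter_upwards [h.eventually (by norm_num)] with z hz
  exact hz.differentiableAt (by norm_num)

lemma ContDiffAt.diff_deriv {g : ℝ → ℝ} {y : ℝ} (h : ContDiffAt ℝ 2 g y) :
    DifferentiableAt ℝ (deriv g) y := by
  have h' : ContDiffWithinAt ℝ 2 g Set.univ y := h
  have := h'.derivWithin (m := 1) uniqueDiffOn_univ (by norm_num) (Set.mem_univ _)
  rw [derivWithin_univ, contDiffWithinAt_univ] at this
  exact this.differentiableAt (by norm_num)

lemma heat_mono {ν : ℝ} (hν : 0 < ν) {f : ℝ → ℝ} {U : ℝ → ℝ → ℝ} (hU : HeatFlow ν f U)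
    (hf : MonotoneOn f (Set.Icc 0 1)) {T : ℝ} (hT : 0 ≤ T) :
    MonotoneOn (U T) (Set.Icc 0 1) := by
  have hcU : ContinuousOn (fun p : ℝ × ℝ => U p.1 p.2) (Set.Icc 0 T ×ˢ Set.Icc 0 1) :=
    hU.1.mono (Set.prod_mono Set.Icc_subset_Ici_self le_rfl)
  have m0 : (0:ℝ) ∈ Set.Icc (0:ℝ) 1 := by simp
  have m1 : (1:ℝ) ∈ Set.Icc (0:ℝ) 1 := by simp
  have hf01 := hf m0 m1 zero_le_one
  have hlow : ∀ t ∈ Set.Icc 0 T, ∀ y ∈ Set.Icc (0:ℝ) 1, 0 ≤ U t y - f 0 := by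
    apply heat_maxprin (W := fun t y => U t y - f 0) hν
    · exact hcU.sub continuousOn_const
    · intro t ht y hy
      obtain ⟨h1, h2, h3⟩ := heat_reg hU ht.1 hy
      refine ⟨h1.sub_const _, ?_⟩
      simp only [deriv_sub_const_fun]
      exact h3
    · intro y hy
      rw [hU.2.2.2.1 y hy]
      linarith [hf m0 hy hy.1]
    · intro t ht
      rw [(hU.2.2.2.2 t ht.1).1]; simp
    · intro t ht
      rw [(hU.2.2.2.2 t ht.1).2]; linarith
  have hupp : ∀ t ∈ Set.Icc 0 T, ∀ y ∈ Set.Icc (0:ℝ) 1, 0 ≤ f 1 - U t y := by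
    apply heat_maxprin (W := fun t y => f 1 - U t y) hν
    · exact continuousOn_const.sub hcU
    · intro t ht y hy
      obtain ⟨h1, h2, h3⟩ := heat_reg hU ht.1 hy
      refine ⟨h1.const_sub _, ?_⟩
      have e : deriv (fun z => f 1 - U t z) = fun z => - deriv (U t) z := by
        funext z; exact deriv_const_sub _
      simp only [e, deriv_const_sub, deriv.fun_neg, h3]
      ring
    · intro y hy
      rw [hU.2.2.2.1 y hy]
      linarith [hf hy m1 hy.2]
    · intro t ht
      rw [(hU.2.2.2.2 t ht.1).1]; linarith
    · intro t ht
      rw [(hU.2.2.2.2 t ht.1).2]; simp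
  intro y hy z hz hyz
  obtain ⟨h, rfl⟩ : ∃ h, z = y + h := ⟨z - y, by ring⟩
  have hh : 0 ≤ h := by linarith
  have hh1 : h ≤ 1 := by linarith [hy.1, hz.2]
  have key : ∀ t ∈ Set.Icc 0 T, ∀ x ∈ Set.Icc (0:ℝ) (1 - h), 0 ≤ U t (x + h) - U t x := by
    apply heat_maxprin (W := fun t x => U t (x + h) - U t x) hν
    · apply ContinuousOn.sub
      · exact hcU.comp (f := fun p : ℝ × ℝ => ((p.1, p.2 + h) : ℝ × ℝ)) (by fun_prop)
          (fun p hp => ⟨hp.1, by linarith [hp.2.1], by linarith [hp.2.2]⟩)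
      · exact hcU.mono (Set.prod_mono le_rfl (Set.Icc_subset_Icc_right (by linarith)))
    · intro t ht x hx
      have hx1 : x ∈ Set.Ioo (0:ℝ) 1 := ⟨hx.1, by linarith [hx.2]⟩
      have hx2 : x + h ∈ Set.Ioo (0:ℝ) 1 := ⟨by linarith [hx.1], by linarith [hx.2]⟩
      obtain ⟨h1, h2, h3⟩ := heat_reg hU ht.1 hx1
      obtain ⟨k1, k2, k3⟩ := heat_reg hU ht.1 hx2
      refine ⟨k1.sub h1, ?_⟩
      have k2' : ContDiffAt ℝ 2 (fun w => U t (w + h)) x :=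
        k2.comp (f := fun w : ℝ => w + h) x (by fun_prop)
      have e : deriv (fun w => U t (w + h) - U t w) =ᶠ[nhds x]
          fun w => deriv (fun w => U t (w + h)) w - deriv (U t) w := by
        filter_upwards [h2.ev_diff, k2'.ev_diff] with w a b
        exact deriv_fun_sub b a
      have e2 : deriv (fun w => U t (w + h)) = fun w => deriv (U t) (w + h) := by
        funext w; exact deriv_comp_add_const _ _ _
      rw [deriv_fun_sub k1 h1, e.deriv_eq, deriv_fun_sub k2'.diff_deriv h2.diff_deriv, h3, k3,
        e2, deriv_comp_add_const]
      ring
    · intro x hx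
      have hx1 : x ∈ Set.Icc (0:ℝ) 1 := ⟨hx.1, by linarith [hx.2]⟩
      have hx2 : x + h ∈ Set.Icc (0:ℝ) 1 := ⟨by linarith [hx.1], by linarith [hx.2]⟩
      rw [hU.2.2.2.1 _ hx1, hU.2.2.2.1 _ hx2]
      linarith [hf hx1 hx2 (by linarith)]
    · intro t ht
      rw [(hU.2.2.2.2 t ht.1).1]
      exact hlow t ht _ ⟨by linarith, by linarith⟩
    · intro t ht
      rw [sub_add_cancel, (hU.2.2.2.2 t ht.1).2]
      exact hupp t ht _ ⟨by linarith, by linarith⟩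
  have := key T ⟨hT, le_rfl⟩ y ⟨hy.1, by linarith [hz.2]⟩
  linarith

lemma dYr_affine {g : ℝ → ℝ} {y : ℝ} (s c : ℝ) (hy : y ∈ Set.Icc (0:ℝ) 1)
    (hg : DifferentiableWithinAt ℝ g (Set.Icc 0 1) y) :
    dYr (fun z => s * g z + c * z) y = s * dYr g y + c := by
  have h := (hg.hasDerivWithinAt.const_mul s).add
    ((hasDerivWithinAt_id y (Set.Icc (0:ℝ) 1)).const_mul c)
  have h2 := h.derivWithin (uniqueDiffOn_Icc_zero_one y hy)
  simp only [mul_one] at h2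
  exact h2

lemma heat_affine {ν : ℝ} {f : ℝ → ℝ} {U : ℝ → ℝ → ℝ} (hU : HeatFlow ν f U) (s c : ℝ) :
    HeatFlow ν (fun y => s * f y + c * y) (fun t y => s * U t y + c * y) := by
  refine ⟨?_, ?_, ?_, ?_, ?_⟩
  · exact (continuousOn_const.mul hU.1).add (by fun_prop)
  · exact (contDiffOn_const.mul hU.2.1).add (by fun_prop)
  · intro t ht y hy
    obtain ⟨h1, h2, h3⟩ := heat_reg hU ht hy
    rw [dYr_dYr _ hy]
    have e : deriv (fun z => s * U t z + c * z) =ᶠ[nhds y] fun z => s * deriv (U t) z + c := by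
      filter_upwards [h2.ev_diff] with z hz
      have := (hz.hasDerivAt.const_mul s).add ((hasDerivAt_id z).const_mul c)
      simp only [mul_one] at this
      exact this.deriv
    rw [e.deriv_eq, deriv_add_const, deriv_const_mul _ h1, deriv_add_const,
      deriv_const_mul _ h2.diff_deriv, h3]
    ring
  · intro y hy
    simp only [hU.2.2.2.1 y hy]
  · intro t ht
    simp only [hU.2.2.2.2 t ht, and_self]

lemma heat_dYr_nonneg {ν : ℝ} (hν : 0 < ν) {f : ℝ → ℝ} {U : ℝ → ℝ → ℝ}
    (hU : HeatFlow ν f U) (hf : DifferentiableOn ℝ f (Set.Icc 0 1)) (s c : ℝ)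
    (hb : ∀ y ∈ Set.Icc (0:ℝ) 1, 0 ≤ s * dYr f y + c) :
    ∀ t ≥ (0:ℝ), ∀ y ∈ Set.Icc (0:ℝ) 1, 0 ≤ s * dYr (U t) y + c := by
  intro t ht y hy
  have hm : MonotoneOn (fun y => s * f y + c * y) (Set.Icc 0 1) := by
    have hd : DifferentiableOn ℝ (fun y => s * f y + c * y) (Set.Icc 0 1) :=
      (hf.const_mul s).add (by fun_prop)
    apply monotoneOn_of_deriv_nonneg (convex_Icc 0 1) hd.continuousOn
      (hd.mono interior_subset)
    intro x hx
    rw [interior_Icc] at hx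
    have hx' := Set.Ioo_subset_Icc_self hx
    rw [← (dYr_eventuallyEq _ hx).eq_of_nhds, dYr_affine s c hx' (hf x hx')]
    exact hb x hx'
  have hmono := heat_mono hν (heat_affine hU s c) hm ht
  have hdU : DifferentiableWithinAt ℝ (U t) (Set.Icc 0 1) y := by
    rcases ht.eq_or_lt with h | h
    · subst h
      exact (hf y hy).congr (fun z hz => hU.2.2.2.1 z hz) (hU.2.2.2.1 y hy)
    · have := (hU.2.1.differentiableOn (by norm_num)) (t, y) ⟨h, hy⟩
      exact this.comp (f := fun z : ℝ => ((t, z) : ℝ × ℝ)) y (by fun_prop)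
        (fun z hz => ⟨h, hz⟩)
  rw [← dYr_affine s c hy hdU]
  exact hmono.derivWithin_nonneg

/-- Uniform lower and upper bounds for `∂_y U` under the heat flow
(Lemma 3.6 (1)). -/
theorem stmt_14 (ν : ℝ) (hν : 0 < ν) (Uin : ℝ → ℝ)
    (hUin : ContDiffOn ℝ 4 Uin (Set.Icc 0 1))
    (U : ℝ → ℝ → ℝ) (hU : HeatFlow ν Uin U)
    (c₀ C₀ : ℝ) (hc₀ : 0 < c₀) (hcC : c₀ ≤ C₀)
    (hcont : ContinuousOn (dYr Uin) (Set.Icc 0 1))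
    (hlb : ∀ y ∈ Set.Icc (0:ℝ) 1, c₀ ≤ dYr Uin y)
    (hub : ∀ y ∈ Set.Icc (0:ℝ) 1, dYr Uin y ≤ C₀) :
    ∀ t ≥ (0:ℝ), ∀ y ∈ Set.Icc (0:ℝ) 1,
      c₀ ≤ dYr (U t) y ∧ dYr (U t) y ≤ C₀ := by
  have hf : DifferentiableOn ℝ Uin (Set.Icc 0 1) := hUin.differentiableOn (by norm_num)
  intro t ht y hy
  have h1 := heat_dYr_nonneg hν hU hf 1 (-c₀) (fun y hy => by linarith [hlb y hy]) t ht y hy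
  have h2 := heat_dYr_nonneg hν hU hf (-1) C₀ (fun y hy => by linarith [hub y hy]) t ht y hy
  constructor <;> linarith
end
end

section
/- Suppose additionally that ∂_y²U^in is continuous on [0,1] with ∂_y²U^in(0)=∂_y²U^in(1)=0 and ∂_y²U^in ≥ 0 on (0,1). Then either ∂_y²U(t,y) = 0 for all t > 0 and y ∈ (0,1), or ∂_y²U(t,y) > 0 for all t > 0 and y ∈ (0,1). Analogously, if ∂_y²U^in ≤ 0 on (0,1), then either ∂_y²U ≡ 0 on (0,∞)×(0,1) or ∂_y²U(t,y) < 0 for all t > 0 and y ∈ (0,1). -/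
open MeasureTheory Set

noncomputable section

open Filter Topology in
lemma aux_second (f f' : ℝ → ℝ) (x c : ℝ) (hmin : IsLocalMin f x)
    (h1 : ∀ᶠ z in 𝓝 x, HasDerivAt f (f' z) z) (h2 : HasDerivAt f' c x) : 0 ≤ c := by
  by_contra hc
  push Not at hc
  have e1 : deriv f =ᶠ[𝓝 x] f' := h1.mono fun z hz => hz.deriv
  have e2 : deriv (deriv f) x = c := by rw [e1.deriv_eq]; exact h2.deriv
  have hmax := isLocalMax_of_deriv_deriv_neg (by rw [e2]; exact hc) hmin.deriv_eq_zero
    h1.self_of_nhds.continuousAt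
  have e3 : f =ᶠ[𝓝 x] fun _ => f x := by
    filter_upwards [hmin, hmax] with z hz hz'
    exact le_antisymm hz' hz
  have e4 : deriv f =ᶠ[𝓝 x] fun _ => 0 := by
    have := e3.deriv
    simpa using this
  have := e4.deriv_eq
  rw [e2] at this
  simp at this
  linarith

open Filter Topology in
lemma aux_left (f : ℝ → ℝ) (x c : ℝ) (hmin : ∀ᶠ z in 𝓝[<] x, f x ≤ f z)
    (h1 : HasDerivAt f c x) : c ≤ 0 := by
  have h2 : Tendsto (slope f x) (𝓝[<] x) (𝓝 c) :=
    (hasDerivWithinAt_iff_tendsto_slope' (by simp)).1 (h1.hasDerivWithinAt (s := Iio x))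
  refine le_of_tendsto h2 ?_
  filter_upwards [hmin, self_mem_nhdsWithin] with z hz hz'
  rw [slope_def_field]
  have : z < x := hz'
  exact div_nonpos_of_nonneg_of_nonpos (by linarith) (by linarith)

open Filter Topology in
lemma wmax (ν : ℝ) (hν : 0 < ν) (a T : ℝ) (l m : ℝ → ℝ) (hl : Continuous l) (hm : Continuous m)
    (v : ℝ → ℝ → ℝ)
    (hv : ContinuousOn (fun p : ℝ × ℝ => v p.1 p.2)
      {p | a ≤ p.1 ∧ p.1 ≤ T ∧ l p.1 ≤ p.2 ∧ p.2 ≤ m p.1})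
    (h0 : ∀ y, l a ≤ y → y ≤ m a → 0 ≤ v a y)
    (hbl : ∀ s, a ≤ s → s ≤ T → 0 ≤ v s (l s))
    (hbm : ∀ s, a ≤ s → s ≤ T → 0 ≤ v s (m s))
    (hint : ∀ s y, a < s → s ≤ T → l s < y → y < m s → ∃ vt vyy : ℝ, ∃ vy : ℝ → ℝ,
      HasDerivAt (fun s => v s y) vt s ∧ (∀ᶠ z in 𝓝 y, HasDerivAt (v s) (vy z) z) ∧
      HasDerivAt vy vyy y ∧ ν * vyy ≤ vt) :
    ∀ s y, a ≤ s → s ≤ T → l s ≤ y → y ≤ m s → 0 ≤ v s y := by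
  intro s0 y0 ha0 hT0 hl0 hm0
  by_contra hneg
  push Not at hneg
  set K : Set (ℝ × ℝ) := {p | a ≤ p.1 ∧ p.1 ≤ T ∧ l p.1 ≤ p.2 ∧ p.2 ≤ m p.1} with hK
  have hKc : IsClosed K := by
    have e1 := isClosed_le (f := fun _ : ℝ × ℝ => a) (g := fun p => p.1) (by fun_prop) (by fun_prop)
    have e2 := isClosed_le (f := fun p : ℝ × ℝ => p.1) (g := fun _ => T) (by fun_prop) (by fun_prop)
    have e3 := isClosed_le (f := fun p : ℝ × ℝ => l p.1) (g := fun p => p.2)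
      (by fun_prop) (by fun_prop)
    have e4 := isClosed_le (f := fun p : ℝ × ℝ => p.2) (g := fun p => m p.1)
      (by fun_prop) (by fun_prop)
    exact e1.inter (e2.inter (e3.inter e4))
  obtain ⟨L, hL⟩ := (isCompact_Icc (a := a) (b := T)).bddBelow_image hl.continuousOn
  obtain ⟨M, hM⟩ := (isCompact_Icc (a := a) (b := T)).bddAbove_image hm.continuousOn
  have hKcomp : IsCompact K := by
    refine (isCompact_Icc (a := a) (b := T)).prod (isCompact_Icc (a := L) (b := M))
      |>.of_isClosed_subset hKc ?_
    rintro ⟨s, y⟩ ⟨h1, h2, h3, h4⟩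
    exact ⟨⟨h1, h2⟩, (hL ⟨s, ⟨h1, h2⟩, rfl⟩).trans h3, h4.trans (hM ⟨s, ⟨h1, h2⟩, rfl⟩)⟩
  obtain ⟨δ, hδ, hδ'⟩ : ∃ δ > 0, v s0 y0 + δ * (s0 - a) < 0 := by
    refine ⟨-v s0 y0 / (2 * (s0 - a + 1)), div_pos (by linarith) (by linarith), ?_⟩
    have h1 : 0 < s0 - a + 1 := by linarith
    have : -v s0 y0 / (2 * (s0 - a + 1)) * (s0 - a) = -v s0 y0 / 2 * ((s0 - a) / (s0 - a + 1)) := by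
      field_simp
    rw [this]
    have h2 : (s0 - a) / (s0 - a + 1) ≤ 1 := by rw [div_le_one h1]; linarith
    nlinarith
  obtain ⟨⟨s, y⟩, hp, hpmin⟩ := hKcomp.exists_isMinOn ⟨(s0, y0), ha0, hT0, hl0, hm0⟩
    (f := fun p : ℝ × ℝ => v p.1 p.2 + δ * (p.1 - a)) (hv.add (by fun_prop))
  have hmin : ∀ s' y', a ≤ s' → s' ≤ T → l s' ≤ y' → y' ≤ m s' →
      v s y + δ * (s - a) ≤ v s' y' + δ * (s' - a) := fun s' y' h1 h2 h3 h4 =>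
    hpmin (a := (s', y')) ⟨h1, h2, h3, h4⟩
  obtain ⟨h1, h2, h3, h4⟩ := hp
  simp only at h1 h2 h3 h4
  have hlt : v s y + δ * (s - a) < 0 := (hmin s0 y0 ha0 hT0 hl0 hm0).trans_lt hδ'
  have hvneg : v s y < 0 := by nlinarith
  have h1' : a < s := lt_of_le_of_ne h1 (by rintro rfl; exact absurd (h0 y h3 h4) (by linarith))
  have h3' : l s < y := lt_of_le_of_ne h3
    (by intro h; have := hbl s h1 h2; rw [h] at this; linarith)
  have h4' : y < m s := lt_of_le_of_ne h4
    (by intro h; have := hbm s h1 h2; rw [← h] at this; linarith)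
  obtain ⟨vt, vyy, vy, d1, d2, d3, hle⟩ := hint s y h1' h2 h3' h4'
  have hvyy : 0 ≤ vyy := by
    refine aux_second (v s) vy y vyy ?_ d2 d3
    filter_upwards [lt_mem_nhds h3', gt_mem_nhds h4'] with z hz hz'
    have := hmin s z h1 h2 hz.le hz'.le
    linarith
  have hvt : vt + δ ≤ 0 := by
    refine aux_left (fun s => v s y + δ * (s - a)) s (vt + δ) ?_ ?_
    · have n1 : ∀ᶠ z in 𝓝 s, l z < y := hl.continuousAt.eventually_lt continuousAt_const h3'
      have n2 : ∀ᶠ z in 𝓝 s, y < m z := continuousAt_const.eventually_lt hm.continuousAt h4'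
      filter_upwards [nhdsWithin_le_nhds n1, nhdsWithin_le_nhds n2,
        nhdsWithin_le_nhds (lt_mem_nhds h1'), self_mem_nhdsWithin] with z e1 e2 e3 e4
      exact hmin z y e3.le ((le_of_lt e4).trans h2) e1.le e2.le
    · have := d1.add (((hasDerivAt_id s).sub_const a).const_mul δ)
      simp only [mul_one] at this
      exact this
  nlinarith

/-- open strip -/
def hOm : Set (ℝ × ℝ) := Ioi 0 ×ˢ Ioo 0 1

lemma hOm_open : IsOpen hOm := isOpen_Ioi.prod isOpen_Ioo

def pd (e : ℝ × ℝ) (F : ℝ × ℝ → ℝ) (p : ℝ × ℝ) : ℝ := fderiv ℝ F p e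

def Sm (F : ℝ × ℝ → ℝ) : Prop := ContDiffOn ℝ (⊤ : ℕ∞) F hOm

lemma Sm.pd {F : ℝ × ℝ → ℝ} (h : Sm F) (e : ℝ × ℝ) : Sm (pd e F) :=
  (ContDiffOn.fderiv_of_isOpen (m := (⊤ : ℕ∞)) h hOm_open (by norm_cast)).clm_apply contDiffOn_const

lemma Sm.at {F : ℝ × ℝ → ℝ} (h : Sm F) {p : ℝ × ℝ} (hp : p ∈ hOm) :
    ContDiffAt ℝ (⊤ : ℕ∞) F p := ContDiffOn.contDiffAt h (hOm_open.mem_nhds hp)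

lemma Sm.diff {F : ℝ × ℝ → ℝ} (h : Sm F) {p : ℝ × ℝ} (hp : p ∈ hOm) :
    DifferentiableAt ℝ F p := (h.at hp).differentiableAt (by simp)

lemma Sm.ht {F : ℝ × ℝ → ℝ} (h : Sm F) {t y : ℝ} (hp : (t, y) ∈ hOm) :
    HasDerivAt (fun s => F (s, y)) (_root_.pd (1, 0) F (t, y)) t :=
  (h.diff hp).hasFDerivAt.comp_hasDerivAt t ((hasDerivAt_id t).prodMk (hasDerivAt_const t y))

lemma Sm.hy {F : ℝ × ℝ → ℝ} (h : Sm F) {t y : ℝ} (hp : (t, y) ∈ hOm) :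
    HasDerivAt (fun z => F (t, z)) (_root_.pd (0, 1) F (t, y)) y :=
  (h.diff hp).hasFDerivAt.comp_hasDerivAt y ((hasDerivAt_const y t).prodMk (hasDerivAt_id y))

lemma Sm.comm {F : ℝ × ℝ → ℝ} (h : Sm F) (e e' : ℝ × ℝ) {p : ℝ × ℝ} (hp : p ∈ hOm) :
    _root_.pd e (_root_.pd e' F) p = _root_.pd e' (_root_.pd e F) p := by
  have hd : DifferentiableAt ℝ (fderiv ℝ F) p :=
    ((h.at hp).fderiv_right (m := 1) (by norm_cast)).differentiableAt (by simp)
  have key : ∀ a b : ℝ × ℝ, _root_.pd a (_root_.pd b F) p = fderiv ℝ (fderiv ℝ F) p a b := by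
    intro a b
    have := (hd.hasFDerivAt.clm_apply (hasFDerivAt_const b p)).fderiv
    change fderiv ℝ (fun q => fderiv ℝ F q b) p a = _
    rw [this]
    simp
  rw [key, key]
  exact (h.at hp).isSymmSndFDerivAt (by simp; norm_cast) _ _

lemma pd_congr {F G : ℝ × ℝ → ℝ} (h : EqOn F G hOm) (e : ℝ × ℝ) : EqOn (pd e F) (pd e G) hOm := by
  intro p hp
  have : F =ᶠ[nhds p] G := Filter.eventuallyEq_of_mem (hOm_open.mem_nhds hp) h
  simp only [pd]
  rw [this.fderiv_eq]

lemma dYr_nhds {f g : ℝ → ℝ} (h : EqOn f g (Ioo 0 1)) {y : ℝ} (hy : y ∈ Ioo (0:ℝ) 1) :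
    dYr f y = deriv g y := by
  have h1 : f =ᶠ[nhds y] g := Filter.eventuallyEq_of_mem (isOpen_Ioo.mem_nhds hy) h
  rw [dYr, derivWithin_of_mem_nhds (Icc_mem_nhds hy.1 hy.2), h1.deriv_eq]

lemma dYr2_eq {U : ℝ → ℝ → ℝ} (h : Sm (fun p => U p.1 p.2)) {t y : ℝ} (ht : 0 < t)
    (hy : y ∈ Ioo (0:ℝ) 1) :
    dYr (dYr (U t)) y = pd (0,1) (pd (0,1) (fun p => U p.1 p.2)) (t, y) := by
  have h1 : EqOn (dYr (U t)) (fun z => pd (0,1) (fun p => U p.1 p.2) (t, z)) (Ioo 0 1) := by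
    intro z hz
    rw [dYr_nhds (fun _ _ => rfl) hz]
    exact (h.hy (t := t) (y := z) ⟨ht, hz⟩).deriv
  rw [dYr_nhds h1 hy]
  exact ((h.pd (0,1)).hy (t := t) (y := y) ⟨ht, hy⟩).deriv

lemma heat_facts {ν : ℝ} {Uin : ℝ → ℝ} {U : ℝ → ℝ → ℝ} (hU : HeatFlow ν Uin U) :
    Sm (fun p => U p.1 p.2) ∧ EqOn (pd (1,0) (fun p => U p.1 p.2))
      (fun p => ν * pd (0,1) (pd (0,1) (fun p => U p.1 p.2)) p) hOm := by
  obtain ⟨-, h2, h3, -, -⟩ := hU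
  have hS : Sm (fun p => U p.1 p.2) :=
    h2.mono (prod_mono le_rfl Ioo_subset_Icc_self)
  refine ⟨hS, ?_⟩
  rintro ⟨t, y⟩ ⟨ht, hy⟩
  have := h3 t ht y hy
  rw [dYr2_eq hS ht hy] at this
  rw [← (hS.ht (t := t) (y := y) ⟨ht, hy⟩).deriv]
  exact this

lemma W_heat {ν : ℝ} {F : ℝ × ℝ → ℝ} (hS : Sm F)
    (hF : EqOn (pd (1,0) F) (fun p => ν * pd (0,1) (pd (0,1) F) p) hOm) :
    EqOn (pd (1,0) (pd (0,1) (pd (0,1) F)))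
      (fun p => ν * pd (0,1) (pd (0,1) (pd (0,1) (pd (0,1) F))) p) hOm := by
  intro p hp
  have e1 := (hS.pd (0,1)).comm (1,0) (0,1) hp
  have e2 : EqOn (pd (1,0) (pd (0,1) F)) (pd (0,1) (pd (1,0) F)) hOm :=
    fun q hq => hS.comm (1,0) (0,1) hq
  have e3 := pd_congr (e2.trans (pd_congr hF (0,1))) (0,1) hp
  have mulc : ∀ G : ℝ × ℝ → ℝ, Sm G →
      EqOn (pd (0,1) (fun p => ν * G p)) (fun p => ν * pd (0,1) G p) hOm := by
    intro G hG q hq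
    simp only [pd]
    rw [((hG.diff hq).hasFDerivAt.const_mul ν).fderiv]
    simp
  have hW := (hS.pd (0,1)).pd (0,1)
  have e4 := pd_congr (mulc _ hW) (0,1) hp
  have e5 := mulc _ (hW.pd (0,1)) hp
  rw [e1, e3, e4, e5]

lemma c_mem {r y1 Y t1 T s : ℝ} (hT : t1 < T) (h1 : t1 ≤ s) (h2 : s ≤ T) (ha : r < y1) (hb : r < Y) :
    r < y1 + (Y - y1) / (T - t1) * (s - t1) := by
  have hTt : 0 < T - t1 := by linarith
  set θ := (s - t1) / (T - t1) with hθ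
  have e : y1 + (Y - y1) / (T - t1) * (s - t1) = y1 + (Y - y1) * θ := by
    rw [hθ]; ring
  have t0 : 0 ≤ θ := div_nonneg (by linarith) hTt.le
  have t1 : θ ≤ 1 := by rw [hθ, div_le_one hTt]; linarith
  rw [e]
  by_cases h : θ = 1
  · rw [h]; linarith
  · have : θ < 1 := lt_of_le_of_ne t1 h
    nlinarith

open Filter Topology in
lemma propagate {ν : ℝ} (hν : 0 < ν) {W : ℝ × ℝ → ℝ} (hS : Sm W)
    (hW : EqOn (pd (1,0) W) (fun p => ν * pd (0,1) (pd (0,1) W) p) hOm)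
    (hpos : ∀ p ∈ hOm, 0 ≤ W p) {t1 y1 T Y : ℝ} (ht1 : 0 < t1) (hy1 : y1 ∈ Ioo (0:ℝ) 1)
    (hT : t1 < T) (hY : Y ∈ Ioo (0:ℝ) 1) (h1 : 0 < W (t1, y1)) : 0 < W (T, Y) := by
  obtain ⟨ε, hε, hε'⟩ : ∃ ε, 0 < ε ∧ ε < W (t1, y1) := exists_between h1
  have hcy : ContinuousAt (fun y => W (t1, y)) y1 :=
    (hS.hy (t := t1) (y := y1) ⟨ht1, hy1⟩).continuousAt
  obtain ⟨ρ, hρ, hρ'⟩ := Metric.eventually_nhds_iff.1 (hcy.eventually (lt_mem_nhds hε'))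
  obtain ⟨r, hr, hr'⟩ : ∃ r, 0 < r ∧ r < min ρ (min (min y1 (1 - y1)) (min Y (1 - Y))) := by
    apply exists_between
    simp only [lt_min_iff]
    exact ⟨hρ, ⟨hy1.1, by linarith [hy1.2]⟩, hY.1, by linarith [hY.2]⟩
  simp only [lt_min_iff] at hr'
  obtain ⟨r1, ⟨r2, r3⟩, r4, r5⟩ := hr'
  set k := (Y - y1) / (T - t1) with hk
  set c : ℝ → ℝ := fun s => y1 + k * (s - t1) with hc
  have hcl : ∀ s, t1 ≤ s → s ≤ T → r < c s := fun s a b => c_mem hT a b r2 r4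
  have hcr : ∀ s, t1 ≤ s → s ≤ T → c s < 1 - r := by
    intro s a b
    have := c_mem hT a b r3 r5
    have e : 1 - y1 + (1 - Y - (1 - y1)) / (T - t1) * (s - t1) = 1 - c s := by
      simp only [hc, hk]; ring
    rw [e] at this
    linarith
  set α := k ^ 2 / ν + 4 * ν / r ^ 2 with hα
  set A := ε / r ^ 4 with hA
  have hA0 : 0 < A := by positivity
  have hmem : ∀ s y, t1 ≤ s → s ≤ T → c s - r ≤ y → y ≤ c s + r → (s, y) ∈ hOm := by
    intro s y a b d e
    have := hcl s a b
    have := hcr s a b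
    exact ⟨lt_of_lt_of_le ht1 a, by linarith, by linarith⟩
  have hfin := wmax ν hν t1 T (fun s => c s - r) (fun s => c s + r) (by fun_prop) (by fun_prop)
    (fun s y => W (s, y) - A * Real.exp (-α * (s - t1)) * (r ^ 2 - (y - c s) ^ 2) ^ 2)
    ?_ ?_ ?_ ?_ ?_ T Y hT.le le_rfl
  · have hcT : c T = Y := by
      have : T - t1 ≠ 0 := by linarith
      simp only [hc, hk]; field_simp; ring
    have := hfin (by rw [hcT]; linarith) (by rw [hcT]; linarith)
    rw [hcT] at this
    have h2 : 0 < A * Real.exp (-α * (T - t1)) * (r ^ 2 - (Y - Y) ^ 2) ^ 2 := by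
      have : (r ^ 2 - (Y - Y) ^ 2) ^ 2 = r ^ 4 := by ring
      rw [this]
      positivity
    linarith
  · refine ContinuousOn.sub (f := fun p : ℝ × ℝ => W p) ?_ (by fun_prop)
    refine (ContDiffOn.continuousOn hS).mono ?_
    rintro ⟨s, y⟩ ⟨a, b, d, e⟩
    exact hmem s y a b d e
  · intro y a b
    have hct : c t1 = y1 := by simp [hc]
    rw [hct] at a b ⊢
    have h2 : ε < W (t1, y) := hρ' (by
      rw [Real.dist_eq, abs_lt]; constructor <;> linarith)
    have h3 : (r ^ 2 - (y - y1) ^ 2) ^ 2 ≤ r ^ 4 := by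
      have h5 : (y - y1) ^ 2 ≤ r ^ 2 := by
        apply sq_le_sq'
        · linarith
        · linarith
      nlinarith [sq_nonneg (y - y1)]
    have h4 : A * (r ^ 2 - (y - y1) ^ 2) ^ 2 ≤ A * r ^ 4 := by gcongr
    have h6 : A * r ^ 4 = ε := by rw [hA]; field_simp
    simp only [sub_self, mul_zero, Real.exp_zero, mul_one]
    linarith
  · intro s a b
    have := hpos _ (hmem s (c s - r) a b (by linarith) (by linarith))
    have e : (r ^ 2 - (c s - r - c s) ^ 2) ^ 2 = 0 := by ring
    simp only [e]
    linarith
  · intro s a b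
    have := hpos _ (hmem s (c s + r) a b (by linarith) (by linarith))
    have e : (r ^ 2 - (c s + r - c s) ^ 2) ^ 2 = 0 := by ring
    simp only [e]
    linarith
  · intro s y a b d e
    have hm := hmem s y a.le b d.le e.le
    set E := Real.exp (-α * (s - t1)) with hE
    have hE0 : 0 < E := Real.exp_pos _
    refine ⟨pd (1,0) W (s, y) - (A * (E * (-α)) * (r ^ 2 - (y - c s) ^ 2) ^ 2 +
        A * E * (4 * (r ^ 2 - (y - c s) ^ 2) * (y - c s) * k)),
      pd (0,1) (pd (0,1) W) (s, y) - A * E * (8 * (y - c s) ^ 2 - 4 * (r ^ 2 - (y - c s) ^ 2)),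
      fun z => pd (0,1) W (s, z) - A * E * (-4 * (r ^ 2 - (z - c s) ^ 2) * (z - c s)),
      ?_, ?_, ?_, ?_⟩
    · refine (hS.ht hm).sub ?_
      have g1 : HasDerivAt (fun s => A * Real.exp (-α * (s - t1))) (A * (E * (-α))) s := by
        have := ((((hasDerivAt_id s).sub_const t1).const_mul (-α)).exp).const_mul A
        refine this.congr_deriv ?_
        simp [hE]
      have g2 : HasDerivAt c k s := by
        have := (((hasDerivAt_id s).sub_const t1).const_mul k).const_add y1
        refine this.congr_deriv ?_
        simp
      have g3 := ((((g2.const_sub y).fun_pow 2).const_sub (r ^ 2)).fun_pow 2)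
      refine (g1.fun_mul g3).congr_deriv ?_
      push_cast
      ring
    · have : ∀ᶠ z in 𝓝 y, (s, z) ∈ hOm :=
        (Continuous.prodMk_right s).continuousAt.preimage_mem_nhds (hOm_open.mem_nhds hm)
      filter_upwards [this] with z hz
      refine (hS.hy hz).sub ?_
      have g3 := (((((hasDerivAt_id' z).sub_const (c s)).fun_pow 2).const_sub (r ^ 2)).fun_pow 2).const_mul (A * E)
      refine g3.congr_deriv ?_
      push_cast
      ring
    · refine ((hS.pd (0,1)).hy hm).sub ?_
      have g0 := (hasDerivAt_id' y).sub_const (c s)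
      have g3 := ((((g0.fun_pow 2).const_sub (r ^ 2)).const_mul (-4)).fun_mul g0).const_mul (A * E)
      refine g3.congr_deriv ?_
      push_cast
      ring
    · rw [hW hm]
      simp only
      set x := y - c s
      have key : 0 ≤ ν * (8 * x ^ 2 - 4 * (r ^ 2 - x ^ 2)) + α * (r ^ 2 - x ^ 2) ^ 2
          - 4 * (r ^ 2 - x ^ 2) * x * k := by
        have : ν * (8 * x ^ 2 - 4 * (r ^ 2 - x ^ 2)) + α * (r ^ 2 - x ^ 2) ^ 2
          - 4 * (r ^ 2 - x ^ 2) * x * k =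
          4 * ν / r ^ 2 * (x ^ 2) ^ 2 + (2 * ν * x - k * (r ^ 2 - x ^ 2)) ^ 2 / ν := by
          rw [hα]; field_simp; ring
        rw [this]; positivity
      have := mul_nonneg (mul_pos hA0 hE0).le key
      linarith

open Topology in
lemma ev_hOm {s y : ℝ} (hm : (s, y) ∈ hOm) : ∀ᶠ z in 𝓝 y, (s, z) ∈ hOm :=
  (Continuous.prodMk_right s).continuousAt.preimage_mem_nhds (hOm_open.mem_nhds hm)

/-- Comparison of the flow with a smooth convex stationary profile at time `a`. -/
lemma comp_stat {ν : ℝ} (hν : 0 < ν) {Uin : ℝ → ℝ} {U : ℝ → ℝ → ℝ} (hU : HeatFlow ν Uin U)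
    (a : ℝ) (ha : 0 ≤ a) (g : ℝ → ℝ) (hgc : ContDiffOn ℝ 2 g (Icc 0 1))
    (hg : ∀ y ∈ Icc (0:ℝ) 1, g y ≤ U a y) (hg0 : g 0 = Uin 0) (hg1 : g 1 = Uin 1)
    (hconv : ∀ y ∈ Ioo (0:ℝ) 1, 0 ≤ dYr (dYr g) y) :
    ∀ t y, a ≤ t → y ∈ Icc (0:ℝ) 1 → g y ≤ U t y := by
  intro t y ht hy
  obtain ⟨hS, hF⟩ := heat_facts hU
  obtain ⟨k1, -, -, -, k5⟩ := hU
  have := wmax ν hν a t (fun _ => 0) (fun _ => 1) continuous_const continuous_const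
    (fun s y => U s y - g y) ?_ ?_ ?_ ?_ ?_ t y ht le_rfl hy.1 hy.2
  · linarith
  · refine ContinuousOn.sub (k1.mono fun p hp => ⟨ha.trans hp.1, hp.2.2⟩) ?_
    exact hgc.continuousOn.comp continuousOn_snd fun p hp => hp.2.2
  · intro y h1 h2
    have := hg y ⟨h1, h2⟩
    linarith
  · intro s h1 h2
    have := (k5 s (ha.trans h1)).1
    linarith
  · intro s h1 h2
    have := (k5 s (ha.trans h1)).2
    linarith
  · intro s y h1 h2 h3 h4
    have hm : (s, y) ∈ hOm := ⟨lt_of_le_of_lt ha h1, h3, h4⟩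
    have hg2 : ∀ z ∈ Ioo (0:ℝ) 1, ContDiffAt ℝ 2 g z := fun z hz =>
      hgc.contDiffAt (Icc_mem_nhds hz.1 hz.2)
    have hd : ∀ z ∈ Ioo (0:ℝ) 1, HasDerivAt g (deriv g z) z := fun z hz =>
      ((hg2 z hz).differentiableAt (by simp)).hasDerivAt
    have hdd : HasDerivAt (deriv g) (dYr (dYr g) y) y := by
      have e1 : EqOn (dYr g) (deriv g) (Ioo 0 1) := fun z hz => dYr_nhds (fun _ _ => rfl) hz
      rw [dYr_nhds e1 ⟨h3, h4⟩]
      refine DifferentiableAt.hasDerivAt ?_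
      have : ContDiffAt ℝ 1 (deriv g) y :=
        ((hgc.mono Ioo_subset_Icc_self).deriv_of_isOpen isOpen_Ioo (by norm_num)).contDiffAt
          (Ioo_mem_nhds h3 h4)
      exact this.differentiableAt (by simp)
    refine ⟨_, _, fun z => pd (0,1) (fun p => U p.1 p.2) (s, z) - deriv g z,
      (hS.ht hm).sub_const _, ?_, ((hS.pd (0,1)).hy hm).sub hdd, ?_⟩
    · filter_upwards [ev_hOm hm] with z hz
      exact (hS.hy hz).sub (hd z hz.2)
    · rw [hF hm]
      have := hconv y ⟨h3, h4⟩
      simp only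
      nlinarith

/-- Time shifts. -/
lemma comp_shift {ν : ℝ} (hν : 0 < ν) {Uin : ℝ → ℝ} {U : ℝ → ℝ → ℝ} (hU : HeatFlow ν Uin U)
    (h : ℝ) (hh : 0 ≤ h) (hg : ∀ y ∈ Icc (0:ℝ) 1, U 0 y ≤ U h y) :
    ∀ t y, 0 ≤ t → y ∈ Icc (0:ℝ) 1 → U t y ≤ U (t + h) y := by
  intro t y ht hy
  obtain ⟨hS, hF⟩ := heat_facts hU
  obtain ⟨k1, -, -, -, k5⟩ := hU
  have := wmax ν hν 0 t (fun _ => 0) (fun _ => 1) continuous_const continuous_const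
    (fun s y => U (s + h) y - U s y) ?_ ?_ ?_ ?_ ?_ t y ht le_rfl hy.1 hy.2
  · linarith
  · refine ContinuousOn.sub ?_ (k1.mono fun p hp => ⟨hp.1, hp.2.2⟩)
    exact k1.comp (f := fun p : ℝ × ℝ => (p.1 + h, p.2)) (by fun_prop)
      fun p hp => ⟨add_nonneg hp.1 hh, hp.2.2⟩
  · intro y h1 h2
    have := hg y ⟨h1, h2⟩
    simp only [zero_add]
    linarith
  · intro s h1 h2
    have := (k5 s h1).1
    have := (k5 (s + h) (by linarith)).1
    linarith
  · intro s h1 h2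
    have := (k5 s h1).2
    have := (k5 (s + h) (by linarith)).2
    linarith
  · intro s y h1 h2 h3 h4
    have hm : (s, y) ∈ hOm := ⟨h1, h3, h4⟩
    have hm' : (s + h, y) ∈ hOm := ⟨add_pos_of_pos_of_nonneg h1 hh, h3, h4⟩
    have d1 := (hS.ht hm').comp_add_const s h
    refine ⟨_, _, fun z => pd (0,1) (fun p => U p.1 p.2) (s + h, z) -
        pd (0,1) (fun p => U p.1 p.2) (s, z),
      d1.sub (hS.ht hm), ?_, ((hS.pd (0,1)).hy hm').sub ((hS.pd (0,1)).hy hm), ?_⟩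
    · filter_upwards [ev_hOm hm, ev_hOm hm'] with z hz hz'
      exact (hS.hy hz').sub (hS.hy hz)
    · rw [hF hm, hF hm']
      simp only
      linarith

lemma dYr2_neg (g : ℝ → ℝ) : dYr (dYr (fun z => -g z)) = fun y => -dYr (dYr g) y := by
  have h : ∀ f : ℝ → ℝ, dYr (fun z => -f z) = fun y => -dYr f y := by
    intro f; funext y; simp only [dYr]; exact derivWithin.fun_neg
  rw [h, h]

lemma heat_neg {ν : ℝ} {Uin : ℝ → ℝ} {U : ℝ → ℝ → ℝ} (hU : HeatFlow ν Uin U) :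
    HeatFlow ν (fun y => -Uin y) (fun t y => -U t y) := by
  obtain ⟨h1, h2, h3, h4, h5⟩ := hU
  refine ⟨h1.neg, h2.neg, ?_, ?_, ?_⟩
  · intro t ht y hy
    rw [dYr2_neg, deriv.fun_neg, h3 t ht y hy]
    ring
  · intro y hy
    simp only [h4 y hy]
  · intro t ht
    simp only [(h5 t ht).1, (h5 t ht).2, and_self]

lemma stmt_pos (ν : ℝ) (hν : 0 < ν) (Uin : ℝ → ℝ)
    (hUin : ContDiffOn ℝ 4 Uin (Set.Icc 0 1))
    (U : ℝ → ℝ → ℝ) (hU : HeatFlow ν Uin U)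
    (hconv : ∀ y ∈ Set.Ioo (0:ℝ) 1, 0 ≤ dYr (dYr Uin) y) :
    ((∀ t > (0:ℝ), ∀ y ∈ Set.Ioo (0:ℝ) 1, dYr (dYr (U t)) y = 0) ∨
        (∀ t > (0:ℝ), ∀ y ∈ Set.Ioo (0:ℝ) 1, 0 < dYr (dYr (U t)) y)) := by
  obtain ⟨hS, hF⟩ := heat_facts hU
  obtain ⟨k1, k2, k3, k4, k5⟩ := id hU
  have hst := comp_stat hν hU 0 le_rfl Uin (hUin.of_le (by norm_num))
    (fun y hy => (k4 y hy).ge) rfl rfl hconv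
  have hmono : ∀ y ∈ Ioo (0:ℝ) 1, MonotoneOn (fun s => U s y) (Ioi 0) := by
    intro y hy s hs t ht hst'
    have := comp_shift hν hU (t - s) (by linarith)
      (fun y hy => by rw [k4 y hy]; exact hst _ y (by linarith) hy) s y (le_of_lt hs) ⟨hy.1.le, hy.2.le⟩
    simpa using this
  set W := pd (0,1) (pd (0,1) (fun p : ℝ × ℝ => U p.1 p.2)) with hWdef
  have hWS : Sm W := (hS.pd _).pd _
  have hWpos : ∀ p ∈ hOm, 0 ≤ W p := by
    rintro ⟨t, y⟩ hp
    have h1 := (hmono y hp.2).derivWithin_nonneg (x := t)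
    rw [derivWithin_of_mem_nhds (Ioi_mem_nhds hp.1), (hS.ht hp).deriv, hF hp] at h1
    exact nonneg_of_mul_nonneg_right h1 hν
  have hWU : ∀ t > (0:ℝ), ∀ y ∈ Ioo (0:ℝ) 1, dYr (dYr (U t)) y = W (t, y) :=
    fun t ht y hy => dYr2_eq hS ht hy
  by_cases hall : ∀ t > (0:ℝ), ∀ y ∈ Set.Ioo (0:ℝ) 1, 0 < dYr (dYr (U t)) y
  · exact Or.inr hall
  left
  push Not at hall
  obtain ⟨t0, ht0, y0, hy0, hle⟩ := hall
  rw [hWU t0 ht0 y0 hy0] at hle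
  have hzero : ∀ a, 0 < a → a < t0 → ∀ y ∈ Ioo (0:ℝ) 1, W (a, y) = 0 := by
    intro a ha hat y hy
    by_contra hne
    have h1 : 0 < W (a, y) := lt_of_le_of_ne (hWpos _ ⟨ha, hy⟩) (Ne.symm hne)
    have := propagate hν hWS (W_heat hS hF) hWpos ha hy hat hy0 h1
    linarith
  intro t ht y hy
  obtain ⟨a, ha, ha'⟩ := exists_between (lt_min ht0 ht)
  rw [lt_min_iff] at ha'
  have hgc : ContDiffOn ℝ 2 (U a) (Icc 0 1) := by
    have h2 : ContDiffOn ℝ 2 (fun p : ℝ × ℝ => U p.1 p.2) (Ioi 0 ×ˢ Icc 0 1) :=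
      k2.of_le (by norm_cast)
    exact h2.comp (f := fun y : ℝ => (a, y)) (by fun_prop) fun z hz => ⟨ha, hz⟩
  have hneg := comp_stat hν (heat_neg hU) a ha.le (fun y => -U a y) hgc.neg
    (fun _ _ => le_rfl) (by simp [(k5 a ha.le).1]) (by simp [(k5 a ha.le).2])
    (fun z hz => by rw [dYr2_neg]; simp only [hWU a ha z hz, hzero a ha ha'.1 z hz]; simp)
  have hconst : (fun s => U s y) =ᶠ[nhds t] fun _ => U a y := by
    filter_upwards [lt_mem_nhds ha'.2] with s hs
    have h1 := hneg s y hs.le ⟨hy.1.le, hy.2.le⟩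
    have h2 := hmono y hy ha (ha.trans hs) hs.le
    simp only at h1 h2
    linarith
  have h3 := k3 t ht y hy
  rw [hconst.deriv_eq] at h3
  simp only [deriv_const] at h3
  rcases mul_eq_zero.1 h3.symm with h | h
  · exact absurd h hν.ne'
  · exact h

/-- Instantaneous positivity property of `∂_y² U` under the heat flow
(Lemma 3.6 (2)). -/
theorem stmt_15 (ν : ℝ) (hν : 0 < ν) (Uin : ℝ → ℝ)
    (hUin : ContDiffOn ℝ 4 Uin (Set.Icc 0 1))
    (U : ℝ → ℝ → ℝ) (hU : HeatFlow ν Uin U)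
    (hcont : ContinuousOn (dYr (dYr Uin)) (Set.Icc 0 1))
    (hb0 : dYr (dYr Uin) 0 = 0) (hb1 : dYr (dYr Uin) 1 = 0) :
    ((∀ y ∈ Set.Ioo (0:ℝ) 1, 0 ≤ dYr (dYr Uin) y) →
      ((∀ t > (0:ℝ), ∀ y ∈ Set.Ioo (0:ℝ) 1, dYr (dYr (U t)) y = 0) ∨
        (∀ t > (0:ℝ), ∀ y ∈ Set.Ioo (0:ℝ) 1, 0 < dYr (dYr (U t)) y))) ∧
    ((∀ y ∈ Set.Ioo (0:ℝ) 1, dYr (dYr Uin) y ≤ 0) →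
      ((∀ t > (0:ℝ), ∀ y ∈ Set.Ioo (0:ℝ) 1, dYr (dYr (U t)) y = 0) ∨
        (∀ t > (0:ℝ), ∀ y ∈ Set.Ioo (0:ℝ) 1, dYr (dYr (U t)) y < 0))) := by
  refine ⟨stmt_pos ν hν Uin hUin U hU, fun h => ?_⟩
  have := stmt_pos ν hν (fun y => -Uin y) hUin.neg (fun t y => -U t y) (heat_neg hU)
    (fun y hy => by rw [dYr2_neg]; have := h y hy; simp only; linarith)
  simp only [dYr2_neg, neg_eq_zero, Left.neg_pos_iff] at this
  exact this
end
end

section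
/- Suppose additionally that U^in satisfies the condition (M): ∂_yU^in(y) ≥ c₀ > 0 on [0,1]; ∂_y²U^in ≥ 0 on (0,1) or ∂_y²U^in ≤ 0 on (0,1); and ∂_y²U^in(0)=∂_y²U^in(1)=0. Then there is an absolute constant C such that: (i) sup_{t≥0} ‖U(t,·)‖_{H⁴(0,1)} ≤ C‖U^in‖_{H⁴(0,1)}; (ii) for all 0 ≤ s ≤ t, ‖U(t,·)−U(s,·)‖_{L^∞(0,1)} ≤ C ν (t−s) ‖U^in‖_{H⁴(0,1)}; (iii) for all 0 ≤ s ≤ t, ‖∂_y²U(t,·)−∂_y²U(s,·)‖_{L²(0,1)} ≤ C ν (t−s) ‖U^in‖_{H⁴(0,1)}. -/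
open MeasureTheory Set

noncomputable section

/-- Iterated derivative within `[0,1]`. -/
def dYn : ℕ → (ℝ → ℝ) → (ℝ → ℝ)
  | 0, g => g
  | n + 1, g => dYr (dYn n g)

/-- The `H⁴(0,1)` norm. -/
def H4norm (g : ℝ → ℝ) : ℝ :=
  Real.sqrt (∑ j ∈ Finset.range 5, ∫ y in Set.Ioo (0:ℝ) 1, (dYn j g y) ^ 2)

/-- Sine coefficient on `[0,1]`. -/
def sinC (n : ℤ) (f : ℝ → ℝ) : ℝ := ∫ y in (0:ℝ)..1, f y * Real.sin (Real.pi * n * y)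

lemma sinC_congr {f g : ℝ → ℝ} (h : ∀ y ∈ Icc (0:ℝ) 1, f y = g y) (n : ℤ) :
    sinC n f = sinC n g := by
  unfold sinC
  apply intervalIntegral.integral_congr
  intro y hy
  rw [uIcc_of_le zero_le_one] at hy
  simp only [h y hy]

lemma parseval_cont (f : ℝ → ℝ) (hf : Continuous f) :
    HasSum (fun n : ℤ => (sinC n f) ^ 2) (∫ y in (0:ℝ)..1, (f y) ^ 2) := by
  set g : ℝ → ℂ := fun x => if x < 0 then -((f (-x) : ℝ) : ℂ) else ((f x : ℝ) : ℂ) with hg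
  have hgm : Measurable g := by
    apply Measurable.ite measurableSet_Iio
    · exact (Complex.continuous_ofReal.comp (hf.comp continuous_neg)).neg.measurable
    · exact (Complex.continuous_ofReal.comp hf).measurable
  obtain ⟨C, hC⟩ := (isCompact_Icc (a := (0:ℝ)) (b := 1)).exists_bound_of_continuousOn
    hf.continuousOn
  have hgb : ∀ x ∈ Ioc (-1:ℝ) 1, ‖g x‖ ≤ C := by
    intro x hx
    simp only [hg]
    split_ifs with h
    · rw [norm_neg, Complex.norm_real]
      exact hC _ ⟨by linarith, by linarith [hx.1]⟩
    · rw [Complex.norm_real]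
      exact hC _ ⟨by linarith, hx.2⟩
  have hmem : MemLp g 2 (volume.restrict (Ioc (-1:ℝ) 1)) := by
    refine MemLp.of_bound hgm.aestronglyMeasurable C ?_
    exact (ae_restrict_iff' measurableSet_Ioc).2 (Filter.Eventually.of_forall hgb)
  have hlt : (-1:ℝ) < 1 := by norm_num
  -- splitting integrals
  have hneg : ∀ (F : ℝ → ℂ), (∫ x in (-1:ℝ)..0, F x) = ∫ x in (0:ℝ)..1, F (-x) := by
    intro F
    rw [intervalIntegral.integral_comp_neg]
    simp
  have key := hasSum_sq_fourierCoeffOn hlt hmem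
  have hgpos : ∀ x : ℝ, 0 ≤ x → g x = f x := by
    intro x hx; simp [hg, not_lt.2 hx]
  have hgneg : ∀ x : ℝ, 0 < x → g (-x) = -f x := by
    intro x hx; simp [hg, hx]
  have hco : ∀ n : ℤ, fourierCoeffOn hlt g n = -Complex.I * (sinC n f : ℝ) := by
    intro n
    rw [fourierCoeffOn_eq_integral]
    have hgint : ∀ a b : ℝ, -1 ≤ a → a ≤ b → b ≤ 1 → IntervalIntegrable
        (fun x : ℝ => fourier (-n) (x : AddCircle ((1:ℝ) - -1)) • g x) volume a b := by
      intro a b ha hab hb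
      have h1 : IntervalIntegrable g volume a b := by
        rw [intervalIntegrable_iff_integrableOn_Ioc_of_le hab]
        have : IntegrableOn g (Ioc (-1:ℝ) 1) :=
          MemLp.integrable (q := 2) (by norm_num) hmem
        exact this.mono_set (Ioc_subset_Ioc ha hb)
      simp only [smul_eq_mul]
      apply h1.continuousOn_mul
      exact ((map_continuous (fourier (-n))).comp
        (AddCircle.continuous_mk' ((1:ℝ) - -1))).continuousOn
    rw [← intervalIntegral.integral_add_adjacent_intervals
      (hgint (-1) 0 (by norm_num) (by norm_num) (by norm_num))
      (hgint 0 1 (by norm_num) (by norm_num) (by norm_num)), hneg]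
    have e1 : (∫ x in (0:ℝ)..1, fourier (-n) (((-x : ℝ)) : AddCircle ((1:ℝ) - -1)) • g (-x))
        = ∫ x in (0:ℝ)..1, -(Complex.exp (Complex.I * (Real.pi * n * x)) * f x) := by
      apply intervalIntegral.integral_congr_Ioo_of_le zero_le_one
      intro x hx
      simp only [smul_eq_mul]
      rw [hgneg x hx.1, fourier_coe_apply, mul_neg]
      congr 3
      push_cast
      ring
    have e2 : (∫ x in (0:ℝ)..1, fourier (-n) ((x : ℝ) : AddCircle ((1:ℝ) - -1)) • g x)
        = ∫ x in (0:ℝ)..1, Complex.exp (-(Complex.I * (Real.pi * n * x))) * f x := by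
      apply intervalIntegral.integral_congr_Ioo_of_le zero_le_one
      intro x hx
      simp only [smul_eq_mul]
      rw [hgpos x hx.1.le, fourier_coe_apply]
      congr 2
      push_cast
      ring
    rw [e1, e2, ← intervalIntegral.integral_add]
    · have : ∀ x : ℝ, -(Complex.exp (Complex.I * (Real.pi * n * x)) * f x) +
          Complex.exp (-(Complex.I * (Real.pi * n * x))) * f x =
          (-2 * Complex.I) * ((f x * Real.sin (Real.pi * n * x) : ℝ) : ℂ) := by
        intro x
        push_cast
        rw [Complex.sin]
        have hI := Complex.I_sq
        have a1 : (-(↑Real.pi * (n:ℂ) * ↑x) * Complex.I) =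
          -(Complex.I * (Real.pi * n * x)) := by ring
        have a2 : ((↑Real.pi * (n:ℂ) * ↑x) * Complex.I) =
          (Complex.I * (Real.pi * n * x)) := by ring
        rw [a1, a2]
        linear_combination (-(f x : ℂ) * (Complex.exp (Complex.I * (Real.pi * n * x)) - Complex.exp (-(Complex.I * (Real.pi * n * x))))) * hI
      simp only [this]
      rw [intervalIntegral.integral_const_mul, intervalIntegral.integral_ofReal]
      unfold sinC
      rw [Complex.real_smul]
      push_cast
      ring
    · apply Continuous.intervalIntegrable
      fun_prop
    · apply Continuous.intervalIntegrable
      fun_prop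
  have hnorm : ((1:ℝ) - -1)⁻¹ • (∫ x in (-1:ℝ)..1, ‖g x‖ ^ 2) = ∫ y in (0:ℝ)..1, (f y) ^ 2 := by
    have hI : IntervalIntegrable (fun x => ‖g x‖ ^ 2) volume (-1) 1 := by
      rw [intervalIntegrable_iff_integrableOn_Ioc_of_le hlt.le]
      exact hmem.integrable_norm_pow (by norm_num)
    have h1 : (∫ x in (-1:ℝ)..0, ‖g x‖ ^ 2) = ∫ y in (0:ℝ)..1, (f y) ^ 2 := by
      have : (∫ x in (0:ℝ)..1, ‖g (-x)‖ ^ 2) = ∫ x in (-1:ℝ)..0, ‖g x‖ ^ 2 := by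
        rw [intervalIntegral.integral_comp_neg (fun x => ‖g x‖ ^ 2)]; simp
      rw [← this]
      apply intervalIntegral.integral_congr_Ioo_of_le zero_le_one
      intro x hx
      simp only [hgneg x hx.1]
      simp
    have h2 : (∫ x in (0:ℝ)..1, ‖g x‖ ^ 2) = ∫ y in (0:ℝ)..1, (f y) ^ 2 := by
      apply intervalIntegral.integral_congr_Ioo_of_le zero_le_one
      intro x hx
      simp only [hgpos x hx.1.le]
      simp
    rw [← intervalIntegral.integral_add_adjacent_intervals (b := 0), h1, h2]
    · rw [smul_eq_mul]; ring
    · exact hI.mono_set (by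
        rw [uIcc_of_le (by norm_num), uIcc_of_le (by norm_num)]
        exact Icc_subset_Icc le_rfl (by norm_num))
    · exact hI.mono_set (by
        rw [uIcc_of_le (by norm_num), uIcc_of_le (by norm_num)]
        exact Icc_subset_Icc (by norm_num) le_rfl)
  rw [hnorm] at key
  convert key using 2 with n
  rw [hco n]
  simp

lemma parseval (f : ℝ → ℝ) (hf : ContinuousOn f (Icc 0 1)) :
    HasSum (fun n : ℤ => (sinC n f) ^ 2) (∫ y in (0:ℝ)..1, (f y) ^ 2) := by
  have h01 : (0:ℝ) ≤ 1 := zero_le_one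
  have hc : Continuous (IccExtend h01 ((Icc (0:ℝ) 1).domRestrict f)) :=
    (continuousOn_iff_continuous_domRestrict.1 hf).Icc_extend'
  have he : ∀ y ∈ Icc (0:ℝ) 1, f y = IccExtend h01 ((Icc (0:ℝ) 1).domRestrict f) y := by
    intro y hy
    rw [IccExtend_of_mem h01 _ hy]; rfl
  have := parseval_cont _ hc
  convert this using 1
  · ext n; rw [sinC_congr he n]
  · apply intervalIntegral.integral_congr
    intro y hy
    rw [uIcc_of_le zero_le_one] at hy
    simp only [← he y hy]

lemma parseval_le {f h : ℝ → ℝ} (hf : ContinuousOn f (Icc 0 1)) (hh : ContinuousOn h (Icc 0 1))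
    (K : ℝ) (H : ∀ n : ℤ, |sinC n f| ≤ K * |sinC n h|) :
    (∫ y in (0:ℝ)..1, (f y) ^ 2) ≤ K ^ 2 * ∫ y in (0:ℝ)..1, (h y) ^ 2 := by
  refine hasSum_le (fun n => ?_) (parseval f hf) ((parseval h hh).mul_left (K ^ 2))
  rw [← sq_abs (sinC n f), ← sq_abs (sinC n h), ← mul_pow]
  exact pow_le_pow_left₀ (abs_nonneg _) (H n) 2

lemma sinC_ibp {u u' u'' : ℝ → ℝ}
    (h1 : ∀ x ∈ Icc (0:ℝ) 1, HasDerivWithinAt u (u' x) (Icc 0 1) x)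
    (h2 : ∀ x ∈ Icc (0:ℝ) 1, HasDerivWithinAt u' (u'' x) (Icc 0 1) x)
    (hc : ContinuousOn u'' (Icc 0 1)) (n : ℤ) :
    sinC n u'' = -(Real.pi * n) * (u 1 * Real.cos (Real.pi * n) - u 0)
      - (Real.pi * n) ^ 2 * sinC n u := by
  have hu : uIcc (0:ℝ) 1 = Icc 0 1 := uIcc_of_le zero_le_one
  have hc1 : ContinuousOn u' (Icc 0 1) := fun x hx => (h2 x hx).continuousWithinAt
  have ds : ∀ x : ℝ, HasDerivAt (fun y => Real.sin (Real.pi * n * y))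
      (Real.pi * n * Real.cos (Real.pi * n * x)) x := by
    intro x
    have := ((hasDerivAt_id x).const_mul (Real.pi * n)).sin
    refine this.congr_deriv ?_
    simp only [id]; ring
  have dc : ∀ x : ℝ, HasDerivAt (fun y => Real.cos (Real.pi * n * y))
      (-(Real.pi * n * Real.sin (Real.pi * n * x))) x := by
    intro x
    have := ((hasDerivAt_id x).const_mul (Real.pi * n)).cos
    refine this.congr_deriv ?_
    simp only [id]; ring
  have i1 := intervalIntegral.integral_mul_deriv_eq_deriv_mul_of_hasDerivWithinAt
    (a := 0) (b := 1) (u := fun y => Real.sin (Real.pi * n * y)) (v := u')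
    (u' := fun x => Real.pi * n * Real.cos (Real.pi * n * x)) (v' := u'')
    (fun x _ => (ds x).hasDerivWithinAt) (by rw [hu]; exact h2)
    (by apply Continuous.intervalIntegrable; fun_prop)
    (by apply ContinuousOn.intervalIntegrable; rw [hu]; exact hc)
  have i2 := intervalIntegral.integral_mul_deriv_eq_deriv_mul_of_hasDerivWithinAt
    (a := 0) (b := 1) (u := fun y => Real.cos (Real.pi * n * y)) (v := u)
    (u' := fun x => -(Real.pi * n * Real.sin (Real.pi * n * x))) (v' := u')
    (fun x _ => (dc x).hasDerivWithinAt) (by rw [hu]; exact h1)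
    (by apply Continuous.intervalIntegrable; fun_prop)
    (by apply ContinuousOn.intervalIntegrable; rw [hu]; exact hc1)
  have e1 : sinC n u'' = ∫ x in (0:ℝ)..1, Real.sin (Real.pi * n * x) * u'' x := by
    unfold sinC; simp only [mul_comm]
  have e2 : (∫ x in (0:ℝ)..1, Real.pi * n * Real.cos (Real.pi * n * x) * u' x) =
      Real.pi * n * ∫ x in (0:ℝ)..1, Real.cos (Real.pi * n * x) * u' x := by
    rw [← intervalIntegral.integral_const_mul]; simp only [mul_assoc]
  have e3 : (∫ x in (0:ℝ)..1, -(Real.pi * n * Real.sin (Real.pi * n * x)) * u x) =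
      -(Real.pi * n) * sinC n u := by
    unfold sinC
    rw [← intervalIntegral.integral_const_mul]
    congr 1; ext x; ring
  have hs : Real.sin (Real.pi * n) = 0 := by rw [mul_comm]; exact Real.sin_int_mul_pi n
  rw [e1, i1, e2, i2, e3]
  simp [hs]
  ring

lemma sobolev {g g' : ℝ → ℝ}
    (h1 : ∀ x ∈ Icc (0:ℝ) 1, HasDerivWithinAt g (g' x) (Icc 0 1) x)
    (hc : ContinuousOn g' (Icc 0 1)) {M : ℝ} (hM0 : 0 ≤ M)
    (hM : (∫ y in (0:ℝ)..1, (g' y) ^ 2) ≤ M ^ 2) :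
    ∀ x ∈ Icc (0:ℝ) 1, ∀ y ∈ Icc (0:ℝ) 1, |g y - g x| ≤ M := by
  have key : ∀ x ∈ Icc (0:ℝ) 1, ∀ y ∈ Icc (0:ℝ) 1, x ≤ y → |g y - g x| ≤ M := by
    intro x hx y hy hxy
    apply abs_le_of_sq_le_sq _ hM0
    have hsub : Icc x y ⊆ Icc 0 1 := Icc_subset_Icc hx.1 hy.2
    have hcc : ContinuousOn g' (uIcc x y) := by rw [uIcc_of_le hxy]; exact hc.mono hsub
    have hI : (∫ z in x..y, g' z) = g y - g x := by
      apply intervalIntegral.integral_eq_sub_of_hasDeriv_right_of_le hxy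
      · exact fun z hz => ((h1 z (hsub hz)).continuousWithinAt).mono hsub
      · intro z hz
        have hz' : z ∈ Ioo (0:ℝ) 1 := ⟨hx.1.trans_lt hz.1, hz.2.trans_le hy.2⟩
        exact ((h1 z (Ioo_subset_Icc_self hz')).hasDerivAt
          (Icc_mem_nhds hz'.1 hz'.2)).hasDerivWithinAt
      · exact hcc.intervalIntegrable
    set d := g y - g x
    have hpos : 0 ≤ ∫ z in x..y, (g' z - d) ^ 2 :=
      intervalIntegral.integral_nonneg hxy (fun z _ => sq_nonneg _)
    have hexp : (∫ z in x..y, (g' z - d) ^ 2) =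
        (∫ z in x..y, (g' z) ^ 2) - 2 * d * d + d ^ 2 * (y - x) := by
      have : ∀ z, (g' z - d) ^ 2 = (g' z) ^ 2 - (2 * d) * g' z + d ^ 2 := by intro z; ring
      simp only [this]
      rw [intervalIntegral.integral_add, intervalIntegral.integral_sub,
        intervalIntegral.integral_const_mul, hI, intervalIntegral.integral_const, smul_eq_mul]
      · ring
      · exact (hcc.pow 2).intervalIntegrable
      · exact (hcc.intervalIntegrable).const_mul _
      · exact ((hcc.pow 2).intervalIntegrable).sub ((hcc.intervalIntegrable).const_mul _)
      · exact intervalIntegrable_const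
    have hmono : (∫ z in x..y, (g' z) ^ 2) ≤ ∫ z in (0:ℝ)..1, (g' z) ^ 2 := by
      apply intervalIntegral.integral_mono_interval hx.1 hxy hy.2
      · exact Filter.Eventually.of_forall fun z => sq_nonneg _
      · apply ContinuousOn.intervalIntegrable
        rw [uIcc_of_le zero_le_one]; exact hc.pow 2
    nlinarith [sq_nonneg d, hx.1, hy.2]
  intro x hx y hy
  rcases le_total x y with h | h
  · exact key x hx y hy h
  · rw [abs_sub_comm]; exact key y hy x hx h

lemma int_sq_le {g : ℝ → ℝ} (hc : ContinuousOn g (Icc 0 1)) {M : ℝ}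
    (hM : ∀ x ∈ Icc (0:ℝ) 1, |g x| ≤ M) : (∫ y in (0:ℝ)..1, (g y) ^ 2) ≤ M ^ 2 := by
  have : (∫ y in (0:ℝ)..1, (g y) ^ 2) ≤ ∫ y in (0:ℝ)..1, M ^ 2 := by
    apply intervalIntegral.integral_mono_on zero_le_one
    · apply ContinuousOn.intervalIntegrable
      rw [uIcc_of_le zero_le_one]; exact hc.pow 2
    · exact intervalIntegrable_const
    · intro x hx
      rw [← sq_abs]
      exact pow_le_pow_left₀ (abs_nonneg _) (hM x hx) 2
  simpa using this

lemma mvt {g g' : ℝ → ℝ}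
    (h1 : ∀ x ∈ Icc (0:ℝ) 1, HasDerivWithinAt g (g' x) (Icc 0 1) x) :
    ∃ c ∈ Icc (0:ℝ) 1, g' c = g 1 - g 0 := by
  obtain ⟨c, hc, h⟩ := exists_hasDerivAt_eq_slope g g' zero_lt_one
    (fun z hz => (h1 z hz).continuousWithinAt)
    (fun z hz => (h1 z (Ioo_subset_Icc_self hz)).hasDerivAt (Icc_mem_nhds hz.1 hz.2))
  exact ⟨c, Ioo_subset_Icc_self hc, by simpa using h⟩

lemma dYn_contDiffOn {g : ℝ → ℝ} (hg : ContDiffOn ℝ 4 g (Icc 0 1)) :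
    ∀ j m : ℕ, j + m ≤ 4 → ContDiffOn ℝ m (dYn j g) (Icc 0 1) := by
  intro j
  induction j with
  | zero => intro m hm; exact hg.of_le (by exact_mod_cast (by omega : m ≤ 4))
  | succ j ih =>
    intro m hm
    have := ih (m + 1) (by omega)
    exact this.derivWithin (uniqueDiffOn_Icc zero_lt_one) (by push_cast; exact le_rfl)

lemma dYn_cont {g : ℝ → ℝ} (hg : ContDiffOn ℝ 4 g (Icc 0 1)) (j : ℕ) (hj : j ≤ 4) :
    ContinuousOn (dYn j g) (Icc 0 1) :=
  (dYn_contDiffOn hg j 0 (by omega)).continuousOn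

lemma dYn_deriv {g : ℝ → ℝ} (hg : ContDiffOn ℝ 4 g (Icc 0 1)) (j : ℕ) (hj : j < 4) :
    ∀ x ∈ Icc (0:ℝ) 1, HasDerivWithinAt (dYn j g) (dYn (j + 1) g x) (Icc 0 1) x := by
  intro x hx
  exact ((dYn_contDiffOn hg j 1 (by omega)).differentiableOn (by simp) x hx).hasDerivWithinAt

lemma dYn_congr {f g : ℝ → ℝ} (h : ∀ y ∈ Icc (0:ℝ) 1, f y = g y) :
    ∀ j, ∀ y ∈ Icc (0:ℝ) 1, dYn j f y = dYn j g y := by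
  intro j
  induction j with
  | zero => exact h
  | succ j ih => intro y hy; exact derivWithin_congr ih (ih y hy)

lemma Ioo_int (f : ℝ → ℝ) : (∫ y in Ioo (0:ℝ) 1, f y) = ∫ y in (0:ℝ)..1, f y := by
  rw [intervalIntegral.integral_of_le zero_le_one, integral_Ioc_eq_integral_Ioo]

lemma uds : UniqueDiffOn ℝ (Ioi (0:ℝ) ×ˢ Icc (0:ℝ) 1) :=
  (uniqueDiffOn_Ioi 0).prod (uniqueDiffOn_Icc zero_lt_one)

/-- time derivative -/
def tD (U : ℝ → ℝ → ℝ) (p : ℝ × ℝ) : ℝ :=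
  fderivWithin ℝ (fun p : ℝ × ℝ => U p.1 p.2) (Ioi (0:ℝ) ×ˢ Icc (0:ℝ) 1) p (1, 0)

lemma tD_cont {ν : ℝ} {Uin : ℝ → ℝ} {U : ℝ → ℝ → ℝ} (hU : HeatFlow ν Uin U) :
    ContinuousOn (tD U) (Ioi (0:ℝ) ×ˢ Icc (0:ℝ) 1) :=
  (hU.2.1.continuousOn_fderivWithin uds (by simp)).clm_apply continuousOn_const

lemma tD_deriv {ν : ℝ} {Uin : ℝ → ℝ} {U : ℝ → ℝ → ℝ} (hU : HeatFlow ν Uin U) {t y : ℝ}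
    (ht : 0 < t) (hy : y ∈ Icc (0:ℝ) 1) : HasDerivAt (fun s => U s y) (tD U (t, y)) t := by
  have h1 := (hU.2.1.differentiableOn (by simp) (t, y) ⟨ht, hy⟩).hasFDerivWithinAt
  have h2 : HasDerivWithinAt (fun s : ℝ => (s, y)) ((1:ℝ), (0:ℝ)) (Ioi 0) t :=
    ((hasDerivAt_id t).prodMk (hasDerivAt_const t y)).hasDerivWithinAt
  have h3 := h1.comp_hasDerivWithinAt t h2
    (fun s (hs : s ∈ Ioi (0:ℝ)) => (⟨hs, hy⟩ : (s, y) ∈ Ioi (0:ℝ) ×ˢ Icc (0:ℝ) 1))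
  exact h3.hasDerivAt (Ioi_mem_nhds ht)

lemma slice {ν : ℝ} {Uin : ℝ → ℝ} {U : ℝ → ℝ → ℝ} (hM : CondM Uin) (hU : HeatFlow ν Uin U) {t : ℝ}
    (ht : 0 ≤ t) : ContDiffOn ℝ 4 (U t) (Icc 0 1) := by
  rcases ht.eq_or_lt with rfl | ht
  · exact hM.1.congr hU.2.2.2.1
  · have h : ContDiffOn ℝ (⊤ : ℕ∞) (fun y : ℝ => ((t, y) : ℝ × ℝ)) (Icc 0 1) :=
      (contDiff_const.prodMk contDiff_id).contDiffOn
    have h2 := hU.2.1.comp h (fun y hy => ⟨ht, hy⟩)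
    exact h2.of_le (by
      have : ((4 : ℕ∞) : WithTop ℕ∞) ≤ ((⊤ : ℕ∞) : WithTop ℕ∞) := WithTop.coe_le_coe.2 le_top
      exact this)

lemma tD_eq {ν : ℝ} {Uin : ℝ → ℝ} {U : ℝ → ℝ → ℝ} (hM : CondM Uin) (hU : HeatFlow ν Uin U) {t : ℝ}
    (ht : 0 < t) : ∀ y ∈ Icc (0:ℝ) 1, tD U (t, y) = ν * dYn 2 (U t) y := by
  have : EqOn (fun y => tD U (t, y)) (fun y => ν * dYn 2 (U t) y) (Icc 0 1) := by
    refine Set.EqOn.of_subset_closure (s := Ioo 0 1) ?_ ?_ ?_ Ioo_subset_Icc_self ?_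
    · intro y hy
      have := (tD_deriv hU ht (Ioo_subset_Icc_self hy)).deriv
      rw [hU.2.2.1 t ht y hy] at this
      exact this.symm
    · exact (tD_cont hU).comp (by fun_prop) (fun y hy => ⟨ht, hy⟩)
    · exact continuousOn_const.mul (dYn_cont (slice hM hU ht.le) 2 (by norm_num))
    · rw [closure_Ioo (by norm_num)]
  exact this

lemma bdry {ν : ℝ} {Uin : ℝ → ℝ} {U : ℝ → ℝ → ℝ} (hν : 0 < ν) (hM : CondM Uin)
    (hU : HeatFlow ν Uin U) {t : ℝ} (ht : 0 ≤ t) :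
    dYn 2 (U t) 0 = 0 ∧ dYn 2 (U t) 1 = 0 := by
  rcases ht.eq_or_lt with rfl | ht
  · rw [dYn_congr hU.2.2.2.1 2 0 (by simp), dYn_congr hU.2.2.2.1 2 1 (by simp)]
    exact hM.2.2.2
  · have key : ∀ y ∈ Icc (0:ℝ) 1, ∀ c : ℝ, (∀ s ≥ (0:ℝ), U s y = c) → dYn 2 (U t) y = 0 := by
      intro y hy c hc
      have h1 := tD_deriv hU ht hy
      have h2 : HasDerivAt (fun s => U s y) 0 t := by
        refine (hasDerivAt_const t c).congr_of_eventuallyEq ?_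
        filter_upwards [Ioi_mem_nhds ht] with s hs
        exact hc s (le_of_lt hs)
      have h3 := h1.unique h2
      rw [tD_eq hM hU ht y hy] at h3
      exact (mul_eq_zero.1 h3).resolve_left hν.ne'
    exact ⟨key 0 (by simp) _ (fun s hs => (hU.2.2.2.2 s hs).1),
      key 1 (by simp) _ (fun s hs => (hU.2.2.2.2 s hs).2)⟩

lemma sinC_deriv {ν : ℝ} {Uin : ℝ → ℝ} {U : ℝ → ℝ → ℝ} (hM : CondM Uin)
    (hU : HeatFlow ν Uin U) {t : ℝ} (ht : 0 < t) (n : ℤ) :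
    HasDerivAt (fun s => sinC n (U s)) (ν * sinC n (dYn 2 (U t))) t := by
  have hcs : ∀ s, 0 < s → ContinuousOn (fun y => U s y * Real.sin (Real.pi * n * y)) (Icc 0 1) :=
    fun s hs => (slice hM hU hs.le).continuousOn.mul (by fun_prop)
  have hcd : ContinuousOn (fun y => tD U (t, y) * Real.sin (Real.pi * n * y)) (Icc 0 1) :=
    ((tD_cont hU).comp (f := fun y : ℝ => (t, y)) (by fun_prop) (fun y hy => ⟨ht, hy⟩)).mul
      (by fun_prop)
  have hK : IsCompact (Icc (t / 2) (2 * t) ×ˢ Icc (0:ℝ) 1) := isCompact_Icc.prod isCompact_Icc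
  obtain ⟨C, hC⟩ := hK.exists_bound_of_continuousOn ((tD_cont hU).mono
    (prod_mono (fun s hs => lt_of_lt_of_le (by linarith) hs.1) le_rfl))
  have hu : uIoc (0:ℝ) 1 = Ioc 0 1 := uIoc_of_le zero_le_one
  have main := intervalIntegral.hasDerivAt_integral_of_dominated_loc_of_deriv_le
    (μ := volume) (a := 0) (b := 1) (s := Icc (t / 2) (2 * t)) (x₀ := t) (bound := fun _ => C)
    (F := fun s y => U s y * Real.sin (Real.pi * n * y))
    (F' := fun s y => tD U (s, y) * Real.sin (Real.pi * n * y))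
    (Icc_mem_nhds (by linarith) (by linarith))
    (by
      filter_upwards [Ioi_mem_nhds ht] with s hs
      rw [hu]
      exact ((hcs s hs).mono Ioc_subset_Icc_self).aestronglyMeasurable measurableSet_Ioc)
    (by
      apply ContinuousOn.intervalIntegrable
      rw [uIcc_of_le zero_le_one]
      exact hcs t ht)
    (by
      rw [hu]
      exact (hcd.mono Ioc_subset_Icc_self).aestronglyMeasurable measurableSet_Ioc)
    (by
      refine Filter.Eventually.of_forall fun y hy s hs => ?_
      rw [hu] at hy
      rw [norm_mul]
      have h1 := hC (s, y) ⟨hs, Ioc_subset_Icc_self hy⟩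
      have h2 : ‖Real.sin (Real.pi * n * y)‖ ≤ 1 := Real.abs_sin_le_one _
      have h3 := norm_nonneg (tD U (s, y))
      nlinarith [norm_nonneg (Real.sin (Real.pi * n * y))])
    intervalIntegrable_const
    (by
      refine Filter.Eventually.of_forall fun y hy s hs => ?_
      rw [hu] at hy
      exact (tD_deriv hU (lt_of_lt_of_le (by linarith) hs.1) (Ioc_subset_Icc_self hy)).mul_const _)
  refine main.2.congr_deriv ?_
  unfold sinC
  rw [← intervalIntegral.integral_const_mul]
  apply intervalIntegral.integral_congr
  intro y hy
  rw [uIcc_of_le zero_le_one] at hy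
  simp only [tD_eq hM hU ht y hy]
  ring

lemma sinC_cont {ν : ℝ} {Uin : ℝ → ℝ} {U : ℝ → ℝ → ℝ}
    (hU : HeatFlow ν Uin U) (n : ℤ) :
    ContinuousOn (fun s => sinC n (U s)) (Ici 0) := by
  have hc : Continuous (fun p : ℝ × ℝ => U (max p.1 0) (max 0 (min 1 p.2))) := by
    have := hU.1.comp_continuous (f := fun p : ℝ × ℝ => (max p.1 0, max 0 (min 1 p.2)))
      (by fun_prop) (fun p => ⟨le_max_right p.1 0, le_max_left _ _, by simp⟩)
    exact this
  have h := intervalIntegral.continuous_parametric_intervalIntegral_of_continuous'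
    (μ := volume) (f := fun s y => U (max s 0) (max 0 (min 1 y)) * Real.sin (Real.pi * n * y))
    (hc.mul (by fun_prop)) 0 1
  refine h.continuousOn.congr ?_
  intro s hs
  simp only [sinC]
  apply intervalIntegral.integral_congr
  intro y hy
  rw [uIcc_of_le zero_le_one] at hy
  simp only
  rw [max_eq_left (show (0:ℝ) ≤ s from hs), min_eq_right hy.2, max_eq_right hy.1]

lemma coef_rel {ν : ℝ} {Uin : ℝ → ℝ} {U : ℝ → ℝ → ℝ} (hM : CondM Uin)
    (hU : HeatFlow ν Uin U) (n : ℤ) {t : ℝ} (ht : 0 ≤ t) :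
    sinC n (dYn 2 (U t)) = -(Real.pi * n) * (Uin 1 * Real.cos (Real.pi * n) - Uin 0)
      - (Real.pi * n) ^ 2 * sinC n (U t) := by
  have hs := slice hM hU ht
  have := sinC_ibp (dYn_deriv hs 0 (by norm_num)) (dYn_deriv hs 1 (by norm_num))
    (dYn_cont hs 2 (by norm_num)) n
  simp only [dYn, (hU.2.2.2.2 t ht).1, (hU.2.2.2.2 t ht).2] at this ⊢
  exact this

lemma coef_evol {ν : ℝ} {Uin : ℝ → ℝ} {U : ℝ → ℝ → ℝ} (hM : CondM Uin)
    (hU : HeatFlow ν Uin U) (n : ℤ) {t : ℝ} (ht : 0 ≤ t) :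
    sinC n (dYn 2 (U t)) =
      Real.exp (-(ν * (Real.pi * n) ^ 2 * t)) * sinC n (dYn 2 (U 0)) := by
  rcases ht.eq_or_lt with rfl | htp
  · simp
  set l := ν * (Real.pi * n) ^ 2 with hl
  set B := -(Real.pi * n) * (Uin 1 * Real.cos (Real.pi * n) - Uin 0) with hB
  have hcont : ContinuousOn (fun s => Real.exp (l * s) * (B - (Real.pi * n) ^ 2 * sinC n (U s)))
      (Icc 0 t) := by
    refine ContinuousOn.mul (by fun_prop) (continuousOn_const.sub (continuousOn_const.mul ?_))
    exact (sinC_cont hU n).mono Icc_subset_Ici_self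
  have hder : ∀ s ∈ Ioo 0 t, HasDerivAt
      (fun s => Real.exp (l * s) * (B - (Real.pi * n) ^ 2 * sinC n (U s))) 0 s := by
    intro s hs
    have h1 := ((hasDerivAt_id s).const_mul l).exp
    have h2 := ((sinC_deriv hM hU hs.1 n).const_mul ((Real.pi * n) ^ 2)).const_sub B
    refine (h1.mul h2).congr_deriv ?_
    rw [coef_rel hM hU n hs.1.le, ← hB, hl]
    simp only [id]
    ring
  obtain ⟨c, hc, h⟩ := exists_hasDerivAt_eq_slope _ _ htp hcont hder
  have h' := (div_eq_zero_iff.1 h.symm).resolve_right (by linarith)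
  rw [← coef_rel hM hU n ht, ← coef_rel hM hU n le_rfl] at h'
  rw [Real.exp_neg, eq_inv_mul_iff_mul_eq₀ (Real.exp_pos _).ne']
  simp only [mul_zero, Real.exp_zero, one_mul] at h'
  linarith

lemma coef4 {ν : ℝ} {Uin : ℝ → ℝ} {U : ℝ → ℝ → ℝ} (hν : 0 < ν) (hM : CondM Uin)
    (hU : HeatFlow ν Uin U) (n : ℤ) {t : ℝ} (ht : 0 ≤ t) :
    sinC n (dYn 4 (U t)) = - (Real.pi * n) ^ 2 * sinC n (dYn 2 (U t)) := by
  have hs := slice hM hU ht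
  rw [sinC_ibp (dYn_deriv hs 2 (by norm_num)) (dYn_deriv hs 3 (by norm_num))
    (dYn_cont hs 4 (by norm_num)) n, (bdry hν hM hU ht).1, (bdry hν hM hU ht).2]
  ring

lemma est4 {ν : ℝ} {Uin : ℝ → ℝ} {U : ℝ → ℝ → ℝ} (hν : 0 < ν) (hM : CondM Uin)
    (hU : HeatFlow ν Uin U) {t : ℝ} (ht : 0 ≤ t) :
    (∫ y in (0:ℝ)..1, (dYn 4 (U t) y) ^ 2) ≤ ∫ y in (0:ℝ)..1, (dYn 4 (U 0) y) ^ 2 := by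
  have := parseval_le (dYn_cont (slice hM hU ht) 4 le_rfl)
    (dYn_cont (slice hM hU le_rfl) 4 le_rfl) 1 (by
      intro n
      rw [coef4 hν hM hU n ht, coef4 hν hM hU n le_rfl, coef_evol hM hU n ht, mul_left_comm,
        abs_mul, abs_of_pos (Real.exp_pos _)]
      apply mul_le_mul_of_nonneg_right _ (abs_nonneg _)
      rw [Real.exp_le_one_iff]
      have : 0 ≤ ν * (Real.pi * n) ^ 2 * t := by positivity
      linarith)
  simpa using this

lemma est2 {ν : ℝ} {Uin : ℝ → ℝ} {U : ℝ → ℝ → ℝ} (hν : 0 < ν) (hM : CondM Uin)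
    (hU : HeatFlow ν Uin U) {s t : ℝ} (hs : 0 ≤ s) (hst : s ≤ t) :
    (∫ y in (0:ℝ)..1, (dYn 2 (U t) y - dYn 2 (U s) y) ^ 2) ≤
      (ν * (t - s)) ^ 2 * ∫ y in (0:ℝ)..1, (dYn 4 (U 0) y) ^ 2 := by
  have ht := hs.trans hst
  have ct := dYn_cont (slice hM hU ht) 2 (by norm_num)
  have cs := dYn_cont (slice hM hU hs) 2 (by norm_num)
  refine parseval_le (f := fun y => dYn 2 (U t) y - dYn 2 (U s) y) (ct.sub cs) (dYn_cont (slice hM hU le_rfl) 4 le_rfl) (ν * (t - s)) ?_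
  intro n
  have hsub : sinC n (fun y => dYn 2 (U t) y - dYn 2 (U s) y) =
      sinC n (dYn 2 (U t)) - sinC n (dYn 2 (U s)) := by
    unfold sinC
    rw [← intervalIntegral.integral_sub]
    · simp only [sub_mul]
    · apply ContinuousOn.intervalIntegrable
      rw [uIcc_of_le zero_le_one]
      exact ct.mul (by fun_prop)
    · apply ContinuousOn.intervalIntegrable
      rw [uIcc_of_le zero_le_one]
      exact cs.mul (by fun_prop)
  rw [hsub, coef4 hν hM hU n le_rfl, coef_evol hM hU n ht, coef_evol hM hU n hs, ← sub_mul,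
    abs_mul, abs_mul, ← mul_assoc, abs_neg,
    abs_of_nonneg (sq_nonneg (Real.pi * (n : ℝ)))]
  apply mul_le_mul_of_nonneg_right _ (abs_nonneg _)
  set l := ν * (Real.pi * n) ^ 2 with hl
  have hl0 : 0 ≤ l := by positivity
  have h1 : Real.exp (-(l * t)) = Real.exp (-(l * s)) * Real.exp (-(l * (t - s))) := by
    rw [← Real.exp_add]; congr 1; ring
  have h2 := Real.add_one_le_exp (-(l * (t - s)))
  have h3 : Real.exp (-(l * (t - s))) ≤ 1 := by
    rw [Real.exp_le_one_iff]
    have := mul_nonneg hl0 (sub_nonneg.2 hst)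
    linarith
  have h4 : Real.exp (-(l * s)) ≤ 1 := by
    rw [Real.exp_le_one_iff]
    have := mul_nonneg hl0 hs
    linarith
  have h5 := Real.exp_pos (-(l * s))
  have h6 : ν * (t - s) * (Real.pi * n) ^ 2 = l * (t - s) := by rw [hl]; ring
  rw [h6, h1, abs_of_nonpos (by nlinarith)]
  nlinarith

/-- Regularity estimates for the heat flow `U(t,y)` (Lemma 3.6 (3)). -/
theorem stmt_16 :
    ∃ C : ℝ, 0 < C ∧
      ∀ (ν : ℝ), 0 < ν → ∀ (Uin : ℝ → ℝ), CondM Uin →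
      ∀ (U : ℝ → ℝ → ℝ), HeatFlow ν Uin U →
        (∀ t ≥ (0:ℝ), H4norm (U t) ≤ C * H4norm Uin) ∧
        (∀ s t : ℝ, 0 ≤ s → s ≤ t →
          (⨆ y : Set.Icc (0:ℝ) 1, |U t (y : ℝ) - U s (y : ℝ)|)
            ≤ C * ν * (t - s) * H4norm Uin) ∧
        (∀ s t : ℝ, 0 ≤ s → s ≤ t →
          Real.sqrt (∫ y in Set.Ioo (0:ℝ) 1,
              (dYr (dYr (U t)) y - dYr (dYr (U s)) y) ^ 2)
            ≤ C * ν * (t - s) * H4norm Uin) := by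
  refine ⟨5, by norm_num, ?_⟩
  intro ν hν Uin hM U hU
  set H := H4norm Uin with hH
  have hH0 : 0 ≤ H := Real.sqrt_nonneg _
  have hnn : ∀ g : ℝ → ℝ, 0 ≤ ∫ y in (0:ℝ)..1, (g y) ^ 2 := fun g =>
    intervalIntegral.integral_nonneg zero_le_one (fun z _ => sq_nonneg _)
  have hH2 : H ^ 2 = ∑ j ∈ Finset.range 5, ∫ y in (0:ℝ)..1, (dYn j Uin y) ^ 2 := by
    rw [hH, H4norm, Real.sq_sqrt (Finset.sum_nonneg fun j _ => by rw [Ioo_int]; exact hnn _)]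
    simp only [Ioo_int]
  have hN : ∀ j < 5, (∫ y in (0:ℝ)..1, (dYn j Uin y) ^ 2) ≤ H ^ 2 := by
    intro j hj
    rw [hH2]
    exact Finset.single_le_sum (f := fun j => ∫ y in (0:ℝ)..1, (dYn j Uin y) ^ 2)
      (fun i _ => hnn _) (Finset.mem_range.2 hj)
  have h40 : (∫ y in (0:ℝ)..1, (dYn 4 (U 0) y) ^ 2) ≤ H ^ 2 := by
    refine le_trans (le_of_eq ?_) (hN 4 (by norm_num))
    apply intervalIntegral.integral_congr
    intro y hy
    rw [uIcc_of_le zero_le_one] at hy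
    simp only [dYn_congr hU.2.2.2.1 4 y hy]
  have z0 : (0:ℝ) ∈ Icc (0:ℝ) 1 := by simp
  have z1 : (1:ℝ) ∈ Icc (0:ℝ) 1 := by simp
  -- boundary values
  have hsob0 := sobolev (dYn_deriv hM.1 0 (by norm_num)) (dYn_cont hM.1 1 (by norm_num)) hH0
    (hN 1 (by norm_num))
  have hba : |Uin 1 - Uin 0| ≤ H := hsob0 0 z0 1 z1
  have ha : |Uin 0| ≤ 2 * H := by
    apply abs_le_of_sq_le_sq _ (by linarith)
    have hc0 : ContinuousOn Uin (Icc 0 1) := hM.1.continuousOn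
    have hI : (∫ y in (0:ℝ)..1, (Uin 0) ^ 2) ≤ ∫ y in (0:ℝ)..1, (2 * (Uin y) ^ 2 + 2 * H ^ 2) := by
      apply intervalIntegral.integral_mono_on zero_le_one intervalIntegrable_const
      · apply ContinuousOn.intervalIntegrable
        rw [uIcc_of_le zero_le_one]
        fun_prop
      · intro y hy
        have h1 : |Uin 0 - Uin y| ≤ H := hsob0 y hy 0 z0
        have h2 := sq_le_sq' (abs_le.1 h1).1 (abs_le.1 h1).2
        nlinarith [sq_nonneg (Uin 0 - 2 * Uin y)]
    rw [intervalIntegral.integral_add, intervalIntegral.integral_const_mul] at hI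
    · have := hN 0 (by norm_num)
      simp only [dYn] at this
      simp at hI
      nlinarith
    · apply ContinuousOn.intervalIntegrable
      rw [uIcc_of_le zero_le_one]
      fun_prop
    · exact intervalIntegrable_const
  have hest : ∀ s t : ℝ, 0 ≤ s → s ≤ t →
      (∫ y in (0:ℝ)..1, (dYn 2 (U t) y - dYn 2 (U s) y) ^ 2) ≤ (ν * (t - s) * H) ^ 2 := by
    intro s t hs hst
    refine (est2 hν hM hU hs hst).trans ?_
    rw [mul_pow (ν * (t - s)) H]
    exact mul_le_mul_of_nonneg_left h40 (sq_nonneg _)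
  refine ⟨?_, ?_, ?_⟩
  · intro t ht
    have hs := slice hM hU ht
    have d := fun j (hj : j < 4) => dYn_deriv hs j hj
    have c := fun j (hj : j ≤ 4) => dYn_cont hs j hj
    have b4 := (est4 hν hM hU ht).trans h40
    have s3 : ∀ y ∈ Icc (0:ℝ) 1, |dYn 3 (U t) y| ≤ H := by
      obtain ⟨z, hz, hz'⟩ := mvt (d 2 (by norm_num))
      rw [(bdry hν hM hU ht).1, (bdry hν hM hU ht).2, sub_zero] at hz'
      intro y hy
      have := sobolev (d 3 (by norm_num)) (c 4 le_rfl) hH0 b4 z hz y hy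
      simp only [Nat.reduceAdd] at hz'
      rwa [hz', sub_zero] at this
    have b3 := int_sq_le (c 3 (by norm_num)) s3
    have s2 : ∀ y ∈ Icc (0:ℝ) 1, |dYn 2 (U t) y| ≤ H := by
      intro y hy
      have := sobolev (d 2 (by norm_num)) (c 3 (by norm_num)) hH0 b3 0 z0 y hy
      rwa [(bdry hν hM hU ht).1, sub_zero] at this
    have b2 := int_sq_le (c 2 (by norm_num)) s2
    have s1 : ∀ y ∈ Icc (0:ℝ) 1, |dYn 1 (U t) y| ≤ 2 * H := by
      obtain ⟨z, hz, hz'⟩ := mvt (d 0 (by norm_num))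
      simp only [Nat.reduceAdd] at hz'
      have e : dYn 0 (U t) 1 - dYn 0 (U t) 0 = Uin 1 - Uin 0 := by
        simp only [dYn, (hU.2.2.2.2 t ht).1, (hU.2.2.2.2 t ht).2]
      rw [e] at hz'
      intro y hy
      have := sobolev (d 1 (by norm_num)) (c 2 (by norm_num)) hH0 b2 z hz y hy
      rw [hz'] at this
      have := abs_le.1 this
      have := abs_le.1 hba
      rw [abs_le]; constructor <;> linarith
    have b1 := int_sq_le (c 1 (by norm_num)) s1
    have s0 : ∀ y ∈ Icc (0:ℝ) 1, |dYn 0 (U t) y| ≤ 4 * H := by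
      intro y hy
      have := sobolev (d 0 (by norm_num)) (c 1 (by norm_num)) (by linarith) b1 0 z0 y hy
      simp only [dYn, (hU.2.2.2.2 t ht).1] at this ⊢
      have := abs_le.1 this
      have := abs_le.1 ha
      rw [abs_le]; constructor <;> linarith
    have b0 := int_sq_le (c 0 (by norm_num)) s0
    unfold H4norm
    apply Real.sqrt_le_iff.2
    refine ⟨by linarith, ?_⟩
    simp only [Ioo_int, Finset.sum_range_succ, Finset.sum_range_zero]
    nlinarith [sq_nonneg H]
  · intro s t hs hst
    have ht := hs.trans hst
    have hK0 : 0 ≤ ν * (t - s) * H := mul_nonneg (mul_nonneg hν.le (sub_nonneg.2 hst)) hH0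
    have hss := slice hM hU hs
    have hts := slice hM hU ht
    have d : ∀ j < 4, ∀ x ∈ Icc (0:ℝ) 1, HasDerivWithinAt
        (fun y => dYn j (U t) y - dYn j (U s) y) (dYn (j+1) (U t) x - dYn (j+1) (U s) x)
        (Icc 0 1) x := fun j hj x hx => (dYn_deriv hts j hj x hx).sub (dYn_deriv hss j hj x hx)
    have c : ∀ j ≤ 4, ContinuousOn (fun y => dYn j (U t) y - dYn j (U s) y) (Icc 0 1) :=
      fun j hj => (dYn_cont hts j hj).sub (dYn_cont hss j hj)
    have s1 : ∀ y ∈ Icc (0:ℝ) 1, |dYn 1 (U t) y - dYn 1 (U s) y| ≤ ν * (t - s) * H := by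
      obtain ⟨z, hz, hz'⟩ := mvt (g' := fun x => dYn 1 (U t) x - dYn 1 (U s) x) (d 0 (by norm_num))
      have e : (dYn 0 (U t) 1 - dYn 0 (U s) 1) - (dYn 0 (U t) 0 - dYn 0 (U s) 0) = 0 := by
        simp only [dYn, (hU.2.2.2.2 t ht).1, (hU.2.2.2.2 t ht).2, (hU.2.2.2.2 s hs).1,
          (hU.2.2.2.2 s hs).2]
        ring
      rw [e] at hz'
      intro y hy
      have := sobolev (g' := fun x => dYn 2 (U t) x - dYn 2 (U s) x) (d 1 (by norm_num))
        (c 2 (by norm_num)) hK0 (hest s t hs hst) z hz y hy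
      rwa [hz', sub_zero] at this
    have b1 := int_sq_le (c 1 (by norm_num)) s1
    apply ciSup_le
    rintro ⟨y, hy⟩
    have := sobolev (g' := fun x => dYn 1 (U t) x - dYn 1 (U s) x) (d 0 (by norm_num))
      (c 1 (by norm_num)) hK0 b1 0 z0 y hy
    simp only [dYn, (hU.2.2.2.2 t ht).1, (hU.2.2.2.2 s hs).1, sub_self, sub_zero] at this
    exact this.trans (by nlinarith)
  · intro s t hs hst
    have hK0 : 0 ≤ ν * (t - s) * H := mul_nonneg (mul_nonneg hν.le (sub_nonneg.2 hst)) hH0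
    rw [Ioo_int]
    have h1 := hest s t hs hst
    have h2 : Real.sqrt (∫ y in (0:ℝ)..1, (dYr (dYr (U t)) y - dYr (dYr (U s)) y) ^ 2) ≤
        ν * (t - s) * H := Real.sqrt_le_iff.2 ⟨hK0, h1⟩
    exact h2.trans (by nlinarith)
end
end

section
/- Let k be an integer and let ψ : [0,1] → ℂ be C² with ψ(0) = ψ(1) = 0, and set ω(y) = ∂_y²ψ(y) − k²ψ(y). Then ∫₀¹ (1−(2y−1)²)(|∂_y²ψ(y)|² + k²|∂_yψ(y)|²) dy ≤ ∫₀¹ (1−(2y−1)²)|ω(y)|² dy. -/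
open MeasureTheory Set

noncomputable section

/-- Derivative within the interval `[0,1]`. -/
def dI (f : ℝ → ℂ) (y : ℝ) : ℂ := derivWithin f (Set.Icc 0 1) y

/-- Weighted elliptic estimate (Lemma A.2):
if `(∂_y² - k²)ψ = ω` and `ψ(0) = ψ(1) = 0`, then
`‖√(1-(2y-1)²) ∂_y u‖_{L²} ≤ ‖√(1-(2y-1)²) ω‖_{L²}`. -/
theorem stmt_18 (k : ℤ) (ψ : ℝ → ℂ)
    (hψ : ContDiffOn ℝ 2 ψ (Set.Icc 0 1))
    (h0 : ψ 0 = 0) (h1 : ψ 1 = 0) :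
    ∫ y in Set.Ioo (0:ℝ) 1,
        (1 - (2 * y - 1) ^ 2) * (‖dI (dI ψ) y‖ ^ 2 + (k : ℝ) ^ 2 * ‖dI ψ y‖ ^ 2)
      ≤ ∫ y in Set.Ioo (0:ℝ) 1,
        (1 - (2 * y - 1) ^ 2) * ‖dI (dI ψ) y - (k : ℂ) ^ 2 * ψ y‖ ^ 2 := by
  have hu := uniqueDiffOn_Icc (zero_lt_one' ℝ)
  have hc0 : ContinuousOn ψ (Icc 0 1) := hψ.continuousOn
  have hC1 : ContDiffOn ℝ 1 (dI ψ) (Icc 0 1) := hψ.derivWithin hu (by norm_num)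
  have hC0 : ContDiffOn ℝ 0 (dI (dI ψ)) (Icc 0 1) := hC1.derivWithin hu (by norm_num)
  have hc1 : ContinuousOn (dI ψ) (Icc 0 1) := hC1.continuousOn
  have hc2 : ContinuousOn (dI (dI ψ)) (Icc 0 1) := hC0.continuousOn
  have hd0 : ∀ y ∈ Ioo (0:ℝ) 1, HasDerivAt ψ (dI ψ y) y := fun y hy =>
    ((hψ.differentiableOn (by norm_num)) y (Ioo_subset_Icc_self hy)).hasDerivWithinAt.hasDerivAt
      (Icc_mem_nhds hy.1 hy.2)
  have hd1 : ∀ y ∈ Ioo (0:ℝ) 1, HasDerivAt (dI ψ) (dI (dI ψ) y) y := fun y hy =>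
    ((hC1.differentiableOn (by norm_num)) y (Ioo_subset_Icc_self hy)).hasDerivWithinAt.hasDerivAt
      (Icc_mem_nhds hy.1 hy.2)
  have hi02 : ContinuousOn (fun y => inner ℝ (dI (dI ψ) y) (ψ y)) (Icc 0 1) := hc2.inner hc0
  have hi01 : ContinuousOn (fun y => inner ℝ (dI ψ y) (ψ y)) (Icc 0 1) := hc1.inner hc0
  have hn0 := hc0.norm
  have hn1 := hc1.norm
  have hn2 := hc2.norm
  set g : ℝ → ℝ := fun y => -2 * (1 - (2 * y - 1) ^ 2) * inner ℝ (dI (dI ψ) y) (ψ y)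
    - 2 * (1 - (2 * y - 1) ^ 2) * ‖dI ψ y‖ ^ 2 - 8 * ‖ψ y‖ ^ 2 with hg
  have hgc : ContinuousOn g (Icc 0 1) := by
    rw [hg]; fun_prop
  have hgi : IntervalIntegrable g volume 0 1 := by
    apply ContinuousOn.intervalIntegrable; rwa [uIcc_of_le zero_le_one]
  have hG : ∫ y in (0:ℝ)..1, g y = 0 := by
    have := intervalIntegral.integral_eq_sub_of_hasDerivAt_of_le (zero_le_one' ℝ)
      (f := fun y => -2 * (1 - (2 * y - 1) ^ 2) * inner ℝ (dI ψ y) (ψ y)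
        + (-4 * (2 * y - 1)) * inner ℝ (ψ y) (ψ y)) (f' := g) ?_ ?_ hgi
    · rw [this]; simp [h0, h1]
    · have : ContinuousOn (fun y => inner ℝ (ψ y) (ψ y)) (Icc 0 1) := hc0.inner hc0
      fun_prop
    · intro y hy
      have hl : HasDerivAt (fun y : ℝ => 2 * y - 1) 2 y := by
        simpa using ((hasDerivAt_id y).const_mul 2).sub_const 1
      have hw := ((hl.pow 2).const_sub 1).const_mul (-2)
      have h := (hw.mul ((hd1 y hy).inner ℝ (hd0 y hy))).add
        ((hl.const_mul (-4)).mul ((hd0 y hy).inner ℝ (hd0 y hy)))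
      refine h.congr_deriv ?_
      simp only [hg, real_inner_self_eq_norm_sq, real_inner_comm (dI ψ y) (ψ y)]
      simp
      ring
  rw [← integral_Ioc_eq_integral_Ioo, ← integral_Ioc_eq_integral_Ioo,
    ← intervalIntegral.integral_of_le zero_le_one, ← intervalIntegral.integral_of_le zero_le_one]
  have key : ∫ y in (0:ℝ)..1, ((1 - (2 * y - 1) ^ 2) *
      (‖dI (dI ψ) y‖ ^ 2 + (k : ℝ) ^ 2 * ‖dI ψ y‖ ^ 2) + (k:ℝ)^2 * g y) ≤
      ∫ y in (0:ℝ)..1, (1 - (2 * y - 1) ^ 2) * ‖dI (dI ψ) y - (k : ℂ) ^ 2 * ψ y‖ ^ 2 := by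
    apply intervalIntegral.integral_mono_on zero_le_one
    · apply ContinuousOn.intervalIntegrable; rw [uIcc_of_le zero_le_one]; fun_prop
    · apply ContinuousOn.intervalIntegrable; rw [uIcc_of_le zero_le_one]; fun_prop
    · intro y hy
      have e : (k : ℂ) ^ 2 * ψ y = ((k:ℝ) ^ 2) • ψ y := by simp
      rw [e, norm_sub_sq_real, inner_smul_right, norm_smul, mul_pow, hg]
      have hw : 0 ≤ 1 - (2 * y - 1) ^ 2 := by nlinarith [hy.1, hy.2]
      have a1 : 0 ≤ (1 - (2 * y - 1) ^ 2) * (‖(k:ℝ)^2‖^2 * ‖ψ y‖^2) := by positivity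
      have a2 : 0 ≤ (1 - (2 * y - 1) ^ 2) * ((k:ℝ)^2 * ‖dI ψ y‖^2) := by positivity
      have a3 : 0 ≤ (k:ℝ)^2 * ‖ψ y‖^2 := by positivity
      linear_combination a1 + a2 + 8 * a3
  rw [intervalIntegral.integral_add, intervalIntegral.integral_const_mul, hG] at key
  · simpa using key
  · apply ContinuousOn.intervalIntegrable; rw [uIcc_of_le zero_le_one]; fun_prop
  · exact hgi.const_mul _
end
end
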